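/- arXiv:2311.05762 — 2 statements merged into one kernel-verified Lean document; each statement's English description precedes it below -/
import Mathlib

section
/- There is an absolute constant C_4 with the following property: if f : F_2^m → F_2^n is a function such that, for x, y selected independently and uniformly at random from F_2^m, the probability that f(x + y) = f(x) + f(y) is at least 1/K, then there exists a group homomorphism g : F_2^m → F_2^n such that, for x uniform in F_2^m, the probability that f(x) = g(x) is at least c·K^{−C_4} for some absolute constant c > 0. -/
set_option linter.unusedSectionVars false
set_option linter.unusedVariables false
namespace PFRx
section
open Classical Finset Real

variable {Ω Ω' S T R : Type} [Fintype Ω] [Fintype Ω']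

noncomputable def law (μ : Ω → ℝ) (X : Ω → S) (s : S) : ℝ := ∑ ω, if X ω = s then μ ω else 0

noncomputable def H (μ : Ω → ℝ) (X : Ω → S) : ℝ := ∑ ω, μ ω * (-log (law μ X (X ω)))

noncomputable def h [Fintype S] (p : S → ℝ) : ℝ := ∑ x, negMulLog (p x)

theorem sum_law_mul [Fintype S] (μ : Ω → ℝ) (X : Ω → S) (φ : S → ℝ) :
    ∑ s, law μ X s * φ s = ∑ ω, μ ω * φ (X ω) := by
  simp only [law, Finset.sum_mul, ite_mul, zero_mul]
  rw [Finset.sum_comm]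
  simp

theorem H_eq_h [Fintype S] (μ : Ω → ℝ) (X : Ω → S) : H μ X = h (law μ X) := by
  unfold H h
  rw [← sum_law_mul μ X (fun s => -log (law μ X s))]
  simp [negMulLog]

theorem law_nonneg {μ : Ω → ℝ} (hμ : ∀ ω, 0 ≤ μ ω) (X : Ω → S) (s : S) : 0 ≤ law μ X s :=
  Finset.sum_nonneg fun ω _ => by split_ifs <;> simp [hμ]

theorem law_ge {μ : Ω → ℝ} (hμ : ∀ ω, 0 ≤ μ ω) (X : Ω → S) (ω : Ω) : μ ω ≤ law μ X (X ω) := by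
  have := Finset.single_le_sum (f := fun ω' => if X ω' = X ω then μ ω' else 0)
    (fun ω' _ => by split_ifs <;> simp [hμ]) (Finset.mem_univ ω)
  simpa [law] using this

theorem law_pos {μ : Ω → ℝ} (hμ : ∀ ω, 0 ≤ μ ω) (X : Ω → S) {ω : Ω} (h0 : μ ω ≠ 0) :
    0 < law μ X (X ω) :=
  lt_of_lt_of_le (lt_of_le_of_ne (hμ ω) (Ne.symm h0)) (law_ge hμ X ω)

theorem sum_law [Fintype S] (μ : Ω → ℝ) (X : Ω → S) : ∑ s, law μ X s = ∑ ω, μ ω := by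
  simpa using sum_law_mul μ X (fun _ => 1)

theorem law_id [Fintype S] (μ : S → ℝ) : law μ (fun x => x) = μ := by
  ext s; simp [law]

theorem law_law [Fintype S] (μ : Ω → ℝ) (X : Ω → S) (f : S → T) :
    law (law μ X) f = law μ (fun ω => f (X ω)) := by
  ext t
  have := sum_law_mul μ X (fun s => if f s = t then 1 else 0)
  simpa [law] using this

theorem H_law [Fintype S] (μ : Ω → ℝ) (X : Ω → S) (f : S → T) :
    H (law μ X) f = H μ (fun ω => f (X ω)) := by
  unfold H
  rw [sum_law_mul μ X (fun s => -log (law (law μ X) f (f s))), law_law]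

theorem H_le_of {μ : Ω → ℝ} (hμ : ∀ ω, 0 ≤ μ ω) (X : Ω → S) (Y : Ω → T)
    (hxy : ∀ ω ω', μ ω ≠ 0 → μ ω' ≠ 0 → X ω = X ω' → Y ω = Y ω') : H μ Y ≤ H μ X := by
  unfold H
  refine Finset.sum_le_sum fun ω _ => ?_
  by_cases h0 : μ ω = 0
  · simp [h0]
  refine mul_le_mul_of_nonneg_left ?_ (hμ ω)
  refine neg_le_neg (Real.log_le_log (law_pos hμ X h0) ?_)
  refine Finset.sum_le_sum fun ω' _ => ?_
  by_cases h1 : μ ω' = 0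
  · simp [h1]
  by_cases h2 : X ω' = X ω
  · simp [h2, hxy ω' ω h1 h0 h2]
  · simp only [h2, if_false]; split_ifs <;> simp [hμ]

theorem H_congr {μ : Ω → ℝ} (hμ : ∀ ω, 0 ≤ μ ω) (X : Ω → S) (Y : Ω → T)
    (hxy : ∀ ω ω', μ ω ≠ 0 → μ ω' ≠ 0 → (X ω = X ω' ↔ Y ω = Y ω')) : H μ X = H μ Y :=
  le_antisymm (H_le_of hμ Y X fun a b ha hb => (hxy a b ha hb).2)
    (H_le_of hμ X Y fun a b ha hb => (hxy a b ha hb).1)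

theorem H_const {μ : Ω → ℝ} (hs : ∑ ω, μ ω = 1) (s : S) : H μ (fun _ => s) = 0 := by
  simp [H, law, hs]

theorem law_equiv (e : Ω' ≃ Ω) (μ : Ω → ℝ) (X : Ω → S) :
    law (fun ω => μ (e ω)) (fun ω => X (e ω)) = law μ X := by
  ext s; unfold law
  exact Equiv.sum_comp e (fun ω => if X ω = s then μ ω else 0)

theorem H_equiv (e : Ω' ≃ Ω) (μ : Ω → ℝ) (X : Ω → S) :
    H (fun ω => μ (e ω)) (fun ω => X (e ω)) = H μ X := by
  unfold H
  rw [law_equiv]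
  exact Equiv.sum_comp e (fun ω => μ ω * -log (law μ X (X ω)))

theorem submod {μ : Ω → ℝ} (hμ : ∀ ω, 0 ≤ μ ω) (X : Ω → S) (Y : Ω → T) (Z : Ω → R) :
    H μ (fun ω => (X ω, Y ω, Z ω)) + H μ Z ≤
      H μ (fun ω => (X ω, Z ω)) + H μ (fun ω => (Y ω, Z ω)) := by
  set a := fun ω => law μ (fun ω => (X ω, Y ω, Z ω)) (X ω, Y ω, Z ω) with ha
  set b := fun ω => law μ Z (Z ω) with hb
  set c := fun ω => law μ (fun ω => (X ω, Z ω)) (X ω, Z ω) with hc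
  set d := fun ω => law μ (fun ω => (Y ω, Z ω)) (Y ω, Z ω) with hd
  have hpos : ∀ ω, μ ω ≠ 0 → 0 < a ω ∧ 0 < b ω ∧ 0 < c ω ∧ 0 < d ω := fun ω h0 =>
    ⟨law_pos hμ (fun ω => (X ω, Y ω, Z ω)) h0, law_pos hμ Z h0,
      law_pos hμ (fun ω => (X ω, Z ω)) h0, law_pos hμ (fun ω => (Y ω, Z ω)) h0⟩
  have key : ∑ ω, μ ω * (c ω * d ω / (a ω * b ω)) ≤ ∑ ω, μ ω := by
    have e1 : ∀ ω, μ ω * (c ω * d ω / (a ω * b ω)) = ∑ ω', ∑ ω'',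
        (if Z ω' = Z ω'' then μ ω' * μ ω'' / b ω' else 0) *
        (if X ω = X ω' ∧ Y ω = Y ω'' ∧ Z ω = Z ω' then μ ω / a ω else 0) := by
      intro ω
      have : c ω * d ω = ∑ ω', ∑ ω'', (if (X ω', Z ω') = (X ω, Z ω) then μ ω' else 0) *
          (if (Y ω'', Z ω'') = (Y ω, Z ω) then μ ω'' else 0) := by
        simp only [hc, hd, law, Finset.sum_mul_sum]
        congr!
      rw [mul_div_assoc', this, Finset.mul_sum, Finset.sum_div]
      refine Finset.sum_congr rfl fun ω' _ => ?_
      rw [Finset.mul_sum, Finset.sum_div]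
      refine Finset.sum_congr rfl fun ω'' _ => ?_
      by_cases h1 : X ω = X ω' ∧ Y ω = Y ω'' ∧ Z ω = Z ω'
      · by_cases h2 : Z ω' = Z ω''
        · have : b ω' = b ω := by simp only [hb, h1.2.2]
          have h3 : Z ω'' = Z ω := by rw [h1.2.2, h2]
          rw [if_pos h1, if_pos h2, if_pos (Prod.ext h1.1.symm h1.2.2.symm),
            if_pos (Prod.ext h1.2.1.symm h3), this]
          field_simp
        · have : ¬ Z ω'' = Z ω := by rw [h1.2.2]; exact fun h => h2 h.symm
          simp [h2, this]
      · rw [if_neg h1]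
        by_cases h3 : X ω' = X ω ∧ Z ω' = Z ω
        · have : ¬ (Y ω'' = Y ω ∧ Z ω'' = Z ω) := by
            rintro ⟨h4, h5⟩; exact h1 ⟨h3.1.symm, h4.symm, h3.2.symm⟩
          simp [this]
        · simp [h3]
    simp_rw [e1]
    rw [Finset.sum_comm]
    refine Finset.sum_le_sum fun ω' _ => ?_
    rw [Finset.sum_comm]
    have e2 : ∀ ω'', ∑ ω, (if Z ω' = Z ω'' then μ ω' * μ ω'' / b ω' else 0) *
        (if X ω = X ω' ∧ Y ω = Y ω'' ∧ Z ω = Z ω' then μ ω / a ω else 0) ≤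
        (if Z ω' = Z ω'' then μ ω' * μ ω'' / b ω' else 0) := by
      intro ω''
      rw [← Finset.mul_sum]
      refine mul_le_of_le_one_right ?_ ?_
      · split_ifs
        · exact div_nonneg (mul_nonneg (hμ _) (hμ _)) (law_nonneg hμ _ _)
        · exact le_rfl
      · have : ∀ ω, (if X ω = X ω' ∧ Y ω = Y ω'' ∧ Z ω = Z ω' then μ ω / a ω else 0) =
          (if (X ω, Y ω, Z ω) = (X ω', Y ω'', Z ω') then μ ω else 0) /
            law μ (fun ω => (X ω, Y ω, Z ω)) (X ω', Y ω'', Z ω') := by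
          intro ω
          by_cases hh : (X ω = X ω' ∧ Y ω = Y ω'' ∧ Z ω = Z ω')
          · simp [hh, ha]
          · simp [hh]
        simp_rw [this]
        rw [← Finset.sum_div]
        convert div_self_le_one (law μ (fun ω => (X ω, Y ω, Z ω)) (X ω', Y ω'', Z ω')) using 2
        unfold law
        congr!
    refine (Finset.sum_le_sum fun ω'' _ => e2 ω'').trans ?_
    have : ∀ ω'', (if Z ω' = Z ω'' then μ ω' * μ ω'' / b ω' else 0) =
        μ ω' * ((if Z ω'' = Z ω' then μ ω'' else 0) / b ω') := by
      intro ω''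
      by_cases h : Z ω' = Z ω''
      · simp [h, mul_div_assoc]
      · have : ¬ Z ω'' = Z ω' := fun h' => h h'.symm
        simp [h, this]
    simp_rw [this]
    rw [← Finset.mul_sum, ← Finset.sum_div]
    exact mul_le_of_le_one_right (hμ _) (div_self_le_one _)
  have hpt : ∀ ω, μ ω - μ ω * (c ω * d ω / (a ω * b ω)) ≤
      μ ω * (-log (c ω)) + μ ω * (-log (d ω)) - μ ω * (-log (a ω)) - μ ω * (-log (b ω)) := by
    intro ω
    by_cases h0 : μ ω = 0
    · simp [h0]
    obtain ⟨p1, p2, p3, p4⟩ := hpos ω h0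
    have := Real.log_le_sub_one_of_pos (x := c ω * d ω / (a ω * b ω)) (by positivity)
    rw [Real.log_div (by positivity) (by positivity), Real.log_mul p3.ne' p4.ne',
      Real.log_mul p1.ne' p2.ne'] at this
    nlinarith [hμ ω]
  have := Finset.sum_le_sum fun ω (_ : ω ∈ Finset.univ) => hpt ω
  simp only [Finset.sum_sub_distrib, Finset.sum_add_distrib] at this
  have h1 : H μ (fun ω => (X ω, Y ω, Z ω)) = ∑ ω, μ ω * (-log (a ω)) := rfl
  have h2 : H μ Z = ∑ ω, μ ω * (-log (b ω)) := rfl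
  have h3 : H μ (fun ω => (X ω, Z ω)) = ∑ ω, μ ω * (-log (c ω)) := rfl
  have h4 : H μ (fun ω => (Y ω, Z ω)) = ∑ ω, μ ω * (-log (d ω)) := rfl
  linarith

theorem subadd {μ : Ω → ℝ} (hμ : ∀ ω, 0 ≤ μ ω) (hs : ∑ ω, μ ω = 1) (X : Ω → S) (Y : Ω → T) :
    H μ (fun ω => (X ω, Y ω)) ≤ H μ X + H μ Y := by
  have := submod hμ X Y (fun _ => ())
  rw [H_const hs] at this
  rw [H_congr hμ (fun ω => (X ω, Y ω, ())) (fun ω => (X ω, Y ω)) (by simp),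
    H_congr hμ (fun ω => (X ω, ())) X (by simp),
    H_congr hμ (fun ω => (Y ω, ())) Y (by simp)] at this
  linarith

def CI (μ : Ω → ℝ) (A : Ω → S) (B : Ω → T) (Z : Ω → R) : Prop :=
  ∀ a b z, law μ (fun ω => (A ω, B ω, Z ω)) (a, b, z) * law μ Z z =
    law μ (fun ω => (A ω, Z ω)) (a, z) * law μ (fun ω => (B ω, Z ω)) (b, z)

theorem CI.H_eq {μ : Ω → ℝ} (hμ : ∀ ω, 0 ≤ μ ω) {A : Ω → S} {B : Ω → T} {Z : Ω → R}
    (hc : CI μ A B Z) : H μ (fun ω => (A ω, B ω, Z ω)) + H μ Z =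
      H μ (fun ω => (A ω, Z ω)) + H μ (fun ω => (B ω, Z ω)) := by
  unfold H
  rw [← Finset.sum_add_distrib, ← Finset.sum_add_distrib]
  refine Finset.sum_congr rfl fun ω _ => ?_
  by_cases h0 : μ ω = 0
  · simp [h0]
  have := congrArg log (hc (A ω) (B ω) (Z ω))
  rw [Real.log_mul (law_pos hμ (fun ω => (A ω, B ω, Z ω)) h0).ne' (law_pos hμ Z h0).ne',
    Real.log_mul (law_pos hμ (fun ω => (A ω, Z ω)) h0).ne'
    (law_pos hμ (fun ω => (B ω, Z ω)) h0).ne'] at this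
  linear_combination (-μ ω) * this

def pm (μ : Ω → ℝ) (ν : Ω' → ℝ) (x : Ω × Ω') : ℝ := μ x.1 * ν x.2

theorem pm_nonneg {μ : Ω → ℝ} {ν : Ω' → ℝ} (hμ : ∀ ω, 0 ≤ μ ω) (hν : ∀ ω, 0 ≤ ν ω) :
    ∀ x, 0 ≤ pm μ ν x := fun x => mul_nonneg (hμ _) (hν _)

theorem pm_sum (μ : Ω → ℝ) (ν : Ω' → ℝ) : ∑ x, pm μ ν x = (∑ x, μ x) * ∑ y, ν y := by
  rw [Fintype.sum_prod_type, Finset.sum_mul_sum]; rfl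

theorem law_pm (μ : Ω → ℝ) (ν : Ω' → ℝ) (A : Ω → S) (B : Ω' → T) (a : S) (b : T) :
    law (pm μ ν) (fun x => (A x.1, B x.2)) (a, b) = law μ A a * law ν B b := by
  unfold law
  rw [Fintype.sum_prod_type, Finset.sum_mul_sum]
  refine Finset.sum_congr rfl fun x _ => Finset.sum_congr rfl fun y _ => ?_
  by_cases h1 : A x = a <;> by_cases h2 : B y = b <;> simp [pm, h1, h2]

theorem law_pm_fst (μ : Ω → ℝ) {ν : Ω' → ℝ} (hs : ∑ y, ν y = 1) (A : Ω → S) :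
    law (pm μ ν) (fun x => A x.1) = law μ A := by
  ext s
  unfold law
  rw [Fintype.sum_prod_type]
  refine Finset.sum_congr rfl fun x _ => ?_
  by_cases h : A x = s
  · simp [h, pm, ← Finset.mul_sum, hs]
  · simp [h]

theorem law_pm_snd {μ : Ω → ℝ} (ν : Ω' → ℝ) (hs : ∑ y, μ y = 1) (A : Ω' → S) :
    law (pm μ ν) (fun x => A x.2) = law ν A := by
  ext s
  unfold law
  rw [Fintype.sum_prod_type, Finset.sum_comm]
  refine Finset.sum_congr rfl fun x _ => ?_
  by_cases h : A x = s
  · simp [h, pm, ← Finset.sum_mul, hs]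
  · simp [h]

theorem H_pm {μ : Ω → ℝ} {ν : Ω' → ℝ} (hμ : ∀ ω, 0 ≤ μ ω) (hν : ∀ ω, 0 ≤ ν ω)
    (hs : ∑ y, μ y = 1) (ht : ∑ y, ν y = 1) (A : Ω → S) (B : Ω' → T) :
    H (pm μ ν) (fun x => (A x.1, B x.2)) = H μ A + H ν B := by
  unfold H
  have : ∀ x : Ω × Ω', pm μ ν x * -log (law (pm μ ν) (fun x => (A x.1, B x.2)) (A x.1, B x.2)) =
      (μ x.1 * -log (law μ A (A x.1))) * ν x.2 + μ x.1 * (ν x.2 * -log (law ν B (B x.2))) := by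
    intro x
    rw [law_pm]
    by_cases h1 : μ x.1 = 0
    · simp [h1, pm]
    by_cases h2 : ν x.2 = 0
    · simp [h2, pm]
    rw [Real.log_mul (law_pos hμ A h1).ne' (law_pos hν B h2).ne', pm]
    ring
  simp_rw [this]
  rw [Finset.sum_add_distrib, Fintype.sum_prod_type, Fintype.sum_prod_type]
  simp [← Finset.mul_sum, ← Finset.sum_mul, hs, ht]

theorem H_pm_fst {μ : Ω → ℝ} {ν : Ω' → ℝ} (ht : ∑ y, ν y = 1) (A : Ω → S) :
    H (pm μ ν) (fun x => A x.1) = H μ A := by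
  unfold H
  rw [law_pm_fst μ ht A, Fintype.sum_prod_type]
  refine Finset.sum_congr rfl fun x _ => ?_
  simp [pm, mul_right_comm _ (ν _), ← Finset.mul_sum, ht]

theorem H_pm_snd {μ : Ω → ℝ} {ν : Ω' → ℝ} (ht : ∑ y, μ y = 1) (A : Ω' → S) :
    H (pm μ ν) (fun x => A x.2) = H ν A := by
  unfold H
  rw [law_pm_snd ν ht A, Fintype.sum_prod_type, Finset.sum_comm]
  refine Finset.sum_congr rfl fun x _ => ?_
  simp [pm, mul_assoc, ← Finset.sum_mul, ht]

theorem CI_pm {S' T' : Type} (μ : Ω → ℝ) (ν : Ω' → ℝ) 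
    (A : Ω → S) (Z : Ω → S') (B : Ω' → T) (W : Ω' → T') :
    CI (pm μ ν) (fun x => A x.1) (fun x => B x.2) (fun x => (Z x.1, W x.2)) := by
  rintro a b ⟨z, w⟩
  have e1 : law (pm μ ν) (fun x => (A x.1, B x.2, Z x.1, W x.2)) (a, b, z, w) =
      law (pm μ ν) (fun x => ((A x.1, Z x.1), (B x.2, W x.2))) ((a, z), (b, w)) := by
    unfold law
    refine Finset.sum_congr rfl fun x _ => ?_
    congr 1
    simp only [Prod.mk.injEq, eq_iff_iff]; tauto
  have e2 : law (pm μ ν) (fun x => (A x.1, Z x.1, W x.2)) (a, z, w) =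
      law (pm μ ν) (fun x => ((A x.1, Z x.1), W x.2)) ((a, z), w) := by
    unfold law
    refine Finset.sum_congr rfl fun x _ => ?_
    congr 1
    simp only [Prod.mk.injEq, eq_iff_iff]; tauto
  have e3 : law (pm μ ν) (fun x => (B x.2, Z x.1, W x.2)) (b, z, w) =
      law (pm μ ν) (fun x => (Z x.1, (B x.2, W x.2))) (z, (b, w)) := by
    unfold law
    refine Finset.sum_congr rfl fun x _ => ?_
    congr 1
    simp only [Prod.mk.injEq, eq_iff_iff]; tauto
  rw [e1, e2, e3, law_pm μ ν (fun x => (A x, Z x)) (fun x => (B x, W x)), law_pm,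
    law_pm μ ν (fun x => (A x, Z x)) W, law_pm μ ν Z (fun x => (B x, W x))]
  ring

end
end PFRx

set_option linter.unusedSectionVars false
set_option linter.unusedVariables false
namespace PFRx
section
open Classical Finset Real

variable {Ω Ω' S T R : Type} [Fintype Ω] [Fintype Ω']

theorem law_congr {μ : Ω → ℝ} {X Y : Ω → S} (hxy : ∀ ω, μ ω ≠ 0 → X ω = Y ω) :
    law μ X = law μ Y := by
  ext s
  refine Finset.sum_congr rfl fun ω _ => ?_
  by_cases h0 : μ ω = 0
  · simp [h0]
  · rw [hxy ω h0]

theorem law_eq_zero {μ : Ω → ℝ} (hμ : ∀ ω, 0 ≤ μ ω) {Z : Ω → T} {z : T} (hz : law μ Z z = 0)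
    (A : Ω → S) (a : S) : law μ (fun ω => (A ω, Z ω)) (a, z) = 0 := by
  have h1 := (Finset.sum_eq_zero_iff_of_nonneg
    (fun ω _ => by split_ifs <;> simp [hμ])).1 hz
  refine Finset.sum_eq_zero fun ω _ => ?_
  have := h1 ω (Finset.mem_univ _)
  by_cases h2 : Z ω = z
  · simp [h2] at this; simp [this]
  · simp [h2]

theorem sum_law_pair [Fintype S] (μ : Ω → ℝ) (A : Ω → S) (Z : Ω → T) (z : T) :
    ∑ a, law μ (fun ω => (A ω, Z ω)) (a, z) = law μ Z z := by
  unfold law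
  rw [Finset.sum_comm]
  refine Finset.sum_congr rfl fun ω _ => ?_
  by_cases h : Z ω = z <;> simp [h]

structure IsP [Fintype S] (p : S → ℝ) : Prop where
  nn : ∀ x, 0 ≤ p x
  s1 : ∑ x, p x = 1

theorem IsP.law [Fintype S] {μ : Ω → ℝ} (hμ : IsP μ) (X : Ω → S) : IsP (law μ X) :=
  ⟨law_nonneg hμ.nn X, by rw [sum_law, hμ.s1]⟩

theorem IsP.pm {μ : Ω → ℝ} {ν : Ω' → ℝ} (hμ : IsP μ) (hν : IsP ν) : IsP (pm μ ν) :=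
  ⟨pm_nonneg hμ.nn hν.nn, by rw [pm_sum, hμ.s1, hν.s1, one_mul]⟩

variable {G : Type} [AddCommGroup G] [Fintype G]

noncomputable def conv (p q : G → ℝ) (z : G) : ℝ := ∑ x, p x * q (z - x)

theorem law_pm_add (μ : Ω → ℝ) (ν : Ω' → ℝ) (A : Ω → G) (B : Ω' → G) :
    law (pm μ ν) (fun x => A x.1 + B x.2) = conv (law μ A) (law ν B) := by
  ext z
  unfold conv
  rw [sum_law_mul μ A (fun a => law ν B (z - a))]
  unfold law
  rw [Fintype.sum_prod_type]
  refine Finset.sum_congr rfl fun x _ => ?_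
  rw [Finset.mul_sum]
  refine Finset.sum_congr rfl fun y _ => ?_
  by_cases h1 : B y = z - A x
  · simp [h1, pm]
  · have : ¬ A x + B y = z := fun h => h1 (by rw [← h]; abel)
    simp [h1, this]

theorem conv_eq_law (p q : G → ℝ) : conv p q = law (pm p q) (fun x => x.1 + x.2) := by
  rw [law_pm_add p q (fun x => x) (fun x => x), law_id, law_id]

theorem H_add (p q : G → ℝ) : H (pm p q) (fun x => x.1 + x.2) = h (conv p q) := by
  rw [H_eq_h, conv_eq_law]

theorem H_id [Fintype S] (p : S → ℝ) : H p (fun x => x) = h p := by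
  rw [H_eq_h, law_id]

theorem IsP.conv {p q : G → ℝ} (hp : IsP p) (hq : IsP q) : IsP (conv p q) := by
  rw [conv_eq_law]; exact (hp.pm hq).law _

theorem conv_comm (p q : G → ℝ) : conv p q = conv q p := by
  ext z
  unfold conv
  rw [← Equiv.sum_comp (Equiv.subLeft z)]
  refine Finset.sum_congr rfl fun x _ => ?_
  simp [mul_comm]

theorem conv_assoc (p q r : G → ℝ) : conv (conv p q) r = conv p (conv q r) := by
  have e1 : conv (conv p q) r = law (pm (pm p q) r) (fun x => (x.1.1 + x.1.2) + x.2) := by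
    rw [law_pm_add (pm p q) r (fun x => x.1 + x.2) (fun x => x), law_id, ← conv_eq_law]
  have e2 : conv p (conv q r) = law (pm p (pm q r)) (fun x => x.1 + (x.2.1 + x.2.2)) := by
    rw [law_pm_add p (pm q r) (fun x => x) (fun x => x.1 + x.2), law_id, ← conv_eq_law]
  rw [e1, e2, ← law_equiv (Equiv.prodAssoc G G G) (pm p (pm q r))]
  congr 1
  · ext x; simp [pm, mul_assoc]
  · ext x; simp [add_assoc]

/-- conditional law -/
noncomputable def cl (μ : Ω → ℝ) (A : Ω → S) (Z : Ω → T) (z : T) (a : S) : ℝ :=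
  law μ (fun ω => (A ω, Z ω)) (a, z) / law μ Z z

theorem IsP.cl [Fintype S] {μ : Ω → ℝ} (hμ : IsP μ) (A : Ω → S) (Z : Ω → T) {z : T}
    (hz : PFRx.law μ Z z ≠ 0) : IsP (cl μ A Z z) := by
  constructor
  · intro a; exact div_nonneg (law_nonneg hμ.nn _ _) (law_nonneg hμ.nn _ _)
  · unfold PFRx.cl
    rw [← Finset.sum_div, sum_law_pair, div_self hz]

theorem avg_h [Fintype S] [Fintype T] {μ : Ω → ℝ} (hμ : IsP μ) (A : Ω → S) (Z : Ω → T) :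
    ∑ z, law μ Z z * h (cl μ A Z z) = H μ (fun ω => (A ω, Z ω)) - H μ Z := by
  rw [H_eq_h, H_eq_h]
  unfold h
  rw [Fintype.sum_prod_type, Finset.sum_comm, ← Finset.sum_sub_distrib]
  refine Finset.sum_congr rfl fun z _ => ?_
  by_cases hz : law μ Z z = 0
  · simp [hz, law_eq_zero hμ.nn hz]
  have : ∀ a, law μ Z z * negMulLog (cl μ A Z z a) =
      negMulLog (law μ (fun ω => (A ω, Z ω)) (a, z)) +
        law μ (fun ω => (A ω, Z ω)) (a, z) * log (law μ Z z) := by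
    intro a
    unfold cl negMulLog
    by_cases h0 : law μ (fun ω => (A ω, Z ω)) (a, z) = 0
    · simp [h0]
    rw [Real.log_div h0 hz]
    field_simp
    ring
  rw [Finset.mul_sum]
  simp_rw [this]
  rw [Finset.sum_add_distrib, ← Finset.sum_mul, sum_law_pair]
  unfold negMulLog
  ring

theorem conv_cl [Fintype T] {μ : Ω → ℝ} {A B : Ω → G} {Z : Ω → T} (hc : CI μ A B Z) {z : T}
    (hz : law μ Z z ≠ 0) :
    conv (cl μ A Z z) (cl μ B Z z) = cl μ (fun ω => A ω + B ω) Z z := by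
  ext g
  unfold conv cl
  have : ∀ x, law μ (fun ω => (A ω, Z ω)) (x, z) / law μ Z z *
      (law μ (fun ω => (B ω, Z ω)) (g - x, z) / law μ Z z) =
      law μ (fun ω => (A ω, B ω, Z ω)) (x, g - x, z) / law μ Z z := by
    intro x
    have := hc x (g - x) z
    field_simp
    linarith
  simp_rw [this]
  rw [← Finset.sum_div]
  congr 1
  unfold law
  rw [Finset.sum_comm]
  refine Finset.sum_congr rfl fun ω _ => ?_
  by_cases h1 : Z ω = z
  · simp only [Prod.mk.injEq, h1, and_true]
    have : ∀ x, (A ω = x ∧ B ω = g - x) ↔ (x = A ω ∧ A ω + B ω = g) := by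
      intro x
      constructor
      · rintro ⟨rfl, h2⟩; rw [h2]; simp
      · rintro ⟨rfl, h2⟩; rw [← h2]; simp
    simp_rw [this]
    by_cases h3 : A ω + B ω = g <;> simp [h3]
  · simp [h1]

theorem avg_conv_le [Fintype T] {μ : Ω → ℝ} (hμ : IsP μ) {p : G → ℝ} (hp : IsP p) (A : Ω → G)
    (Z : Ω → T) : ∑ z, law μ Z z * h (conv p (cl μ A Z z)) ≤ h (conv p (law μ A)) := by
  have e1 : ∀ z, conv p (cl μ A Z z) =
      cl (pm p μ) (fun x => x.1 + A x.2) (fun x => Z x.2) z := by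
    intro z; ext g
    unfold conv cl
    rw [law_pm_snd μ hp.s1 Z]
    simp_rw [mul_div_assoc']
    rw [← Finset.sum_div]
    congr 1
    unfold law
    rw [Fintype.sum_prod_type]
    refine Finset.sum_congr rfl fun x _ => ?_
    rw [Finset.mul_sum]
    refine Finset.sum_congr rfl fun y _ => ?_
    have : (A y, Z y) = (g - x, z) ↔ (x + A y, Z y) = (g, z) := by
      simp only [Prod.mk.injEq]
      rw [eq_sub_iff_add_eq']
    by_cases h1 : (A y, Z y) = (g - x, z)
    · rw [if_pos h1, if_pos (this.1 h1)]; rfl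
    · rw [if_neg h1, if_neg (fun h => h1 (this.2 h)), mul_zero]
  have e2 := avg_h (hp.pm hμ) (fun x => x.1 + A x.2) (fun x => Z x.2)
  rw [law_pm_snd μ hp.s1 Z] at e2
  simp_rw [e1]
  rw [e2]
  have := subadd (hp.pm hμ).nn (hp.pm hμ).s1 (fun x => x.1 + A x.2) (fun x => Z x.2)
  have e3 : H (pm p μ) (fun x => x.1 + A x.2) = h (conv p (law μ A)) := by
    rw [H_eq_h, law_pm_add p μ (fun x => x) A, law_id]
  linarith

theorem exists_le_of_avg [Fintype T] {w f : T → ℝ} (hw : IsP w) {C : ℝ}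
    (hf : ∑ z, w z * f z ≤ C) : ∃ z, w z ≠ 0 ∧ f z ≤ C := by
  by_contra! hcon
  obtain ⟨z0, hz0⟩ : ∃ z, w z ≠ 0 := by
    by_contra! h0
    have := hw.s1
    simp [h0] at this
  have : ∑ z, w z * C < ∑ z, w z * f z := by
    refine Finset.sum_lt_sum (fun z _ => ?_) ⟨z0, Finset.mem_univ _, ?_⟩
    · by_cases hz : w z = 0
      · simp [hz]
      · exact mul_le_mul_of_nonneg_left (hcon z hz).le (hw.nn z)
    · exact mul_lt_mul_of_pos_left (hcon z0 hz0) (lt_of_le_of_ne (hw.nn z0) (Ne.symm hz0))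
  rw [← Finset.sum_mul, hw.s1, one_mul] at this
  linarith

theorem h_conv_ge {p q : G → ℝ} (hp : IsP p) (hq : IsP q) : h q ≤ h (conv p q) := by
  have h1 := subadd (hp.pm hq).nn (hp.pm hq).s1 (fun x => x.1) (fun x => x.1 + x.2)
  rw [H_congr (hp.pm hq).nn (fun x => (x.1, x.1 + x.2)) (fun x => (x.1, x.2))
    (by rintro ⟨a, b⟩ ⟨c, d⟩ _ _; simp +contextual), H_add,
    H_pm hp.nn hq.nn hp.s1 hq.s1 (fun x => x) (fun x => x),
    H_pm_fst hq.s1 (fun x => x), H_id, H_id] at h1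
  linarith

theorem h_conv_ge' {p q : G → ℝ} (hp : IsP p) (hq : IsP q) : h p ≤ h (conv p q) := by
  rw [conv_comm]; exact h_conv_ge hq hp

theorem KV {p q r : G → ℝ} (hp : IsP p) (hq : IsP q) (hr : IsP r) :
    h (conv (conv p q) r) + h q ≤ h (conv p q) + h (conv q r) := by
  have hP := (hp.pm hq).pm hr
  have h1 := submod hP.nn (fun x => x.1.1) (fun x => x.2) (fun x => x.1.1 + x.1.2 + x.2)
  have e1 : H (pm (pm p q) r) (fun x => x.1.1 + x.1.2 + x.2) = h (conv (conv p q) r) := by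
    rw [H_eq_h, law_pm_add (pm p q) r (fun x => x.1 + x.2) (fun x => x), law_id, ← conv_eq_law]
  have e2 : H (pm (pm p q) r) (fun x => (x.2, x.1.1 + x.1.2 + x.2)) = h (conv p q) + h r := by
    rw [← H_add, ← H_id r, ← H_pm (hp.pm hq).nn hr.nn (hp.pm hq).s1 hr.s1]
    refine H_congr hP.nn _ _ ?_
    rintro ⟨⟨a, b⟩, c⟩ ⟨⟨a', b'⟩, c'⟩ _ _
    simp only [Prod.mk.injEq]
    constructor
    · rintro ⟨rfl, h⟩; exact ⟨by simpa using h, rfl⟩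
    · rintro ⟨h, rfl⟩; exact ⟨rfl, by rw [h]⟩
  have e3 : H (pm (pm p q) r) (fun x => (x.1.1, x.2, x.1.1 + x.1.2 + x.2)) = h p + h q + h r := by
    rw [← H_id p, ← H_id q, ← H_id r, ← H_pm hp.nn hq.nn hp.s1 hq.s1,
      ← H_pm (hp.pm hq).nn hr.nn (hp.pm hq).s1 hr.s1]
    refine H_congr hP.nn _ _ ?_
    rintro ⟨⟨a, b⟩, c⟩ ⟨⟨a', b'⟩, c'⟩ _ _
    simp only [Prod.mk.injEq]
    constructor
    · rintro ⟨rfl, rfl, h⟩; exact ⟨⟨rfl, by simpa using h⟩, rfl⟩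
    · rintro ⟨⟨rfl, rfl⟩, rfl⟩; simp
  have e4 : H (pm (pm p q) r) (fun x => (x.1.1, x.1.1 + x.1.2 + x.2)) = h p + h (conv q r) := by
    rw [← H_add, ← H_id p, ← H_pm hp.nn (hq.pm hr).nn hp.s1 (hq.pm hr).s1,
      ← H_equiv (Equiv.prodAssoc G G G) (pm p (pm q r))]
    have : (fun ω => pm p (pm q r) ((Equiv.prodAssoc G G G) ω)) = pm (pm p q) r := by
      ext x; simp [pm, mul_assoc]
    rw [this]
    refine H_congr hP.nn _ _ ?_
    rintro ⟨⟨a, b⟩, c⟩ ⟨⟨a', b'⟩, c'⟩ _ _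
    simp only [Prod.mk.injEq, Equiv.prodAssoc_apply]
    constructor
    · rintro ⟨rfl, h⟩; exact ⟨rfl, by simpa [add_assoc] using h⟩
    · rintro ⟨rfl, h⟩; exact ⟨rfl, by rw [add_assoc, h, add_assoc]⟩
  rw [e1, e2, e3, e4] at h1
  linarith

/-- conditionally independent coupling -/
noncomputable def cp (μ : Ω → ℝ) (Z : Ω → T) (x : Ω × Ω) : ℝ :=
  if Z x.1 = Z x.2 then μ x.1 * μ x.2 / law μ Z (Z x.1) else 0

theorem cp_nonneg {μ : Ω → ℝ} (hμ : ∀ ω, 0 ≤ μ ω) (Z : Ω → T) (x : Ω × Ω) : 0 ≤ cp μ Z x := by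
  unfold cp
  split_ifs
  · exact div_nonneg (mul_nonneg (hμ _) (hμ _)) (law_nonneg hμ _ _)
  · exact le_rfl

theorem cp_swap (μ : Ω → ℝ) (Z : Ω → T) (x y : Ω) : cp μ Z (x, y) = cp μ Z (y, x) := by
  unfold cp
  by_cases h : Z x = Z y
  · simp [h, mul_comm]
  · have : ¬ Z y = Z x := fun h' => h h'.symm
    simp [h, this]

theorem cp_sum {μ : Ω → ℝ} (hμ : ∀ ω, 0 ≤ μ ω) (Z : Ω → T) (x : Ω) :
    ∑ y, cp μ Z (x, y) = μ x := by
  have : ∀ y, cp μ Z (x, y) = μ x * (if Z y = Z x then μ y else 0) / law μ Z (Z x) := by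
    intro y
    unfold cp
    by_cases h : Z x = Z y
    · simp [h]
    · have : ¬ Z y = Z x := fun h' => h h'.symm
      simp [h, this]
  simp_rw [this]
  rw [← Finset.sum_div, ← Finset.mul_sum]
  change μ x * law μ Z (Z x) / law μ Z (Z x) = μ x
  by_cases h0 : μ x = 0
  · simp [h0]
  · rw [mul_div_cancel_right₀ _ (law_pos hμ Z h0).ne']

theorem cp_fst {μ : Ω → ℝ} (hμ : ∀ ω, 0 ≤ μ ω) (Z : Ω → T) (X : Ω → S) :
    law (cp μ Z) (fun x => X x.1) = law μ X := by
  ext s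
  unfold law
  rw [Fintype.sum_prod_type]
  refine Finset.sum_congr rfl fun x _ => ?_
  by_cases h : X x = s
  · simp [h, cp_sum hμ]
  · simp [h]

theorem cp_snd {μ : Ω → ℝ} (hμ : ∀ ω, 0 ≤ μ ω) (Z : Ω → T) (X : Ω → S) :
    law (cp μ Z) (fun x => X x.2) = law μ X := by
  ext s
  unfold law
  rw [Fintype.sum_prod_type, Finset.sum_comm]
  refine Finset.sum_congr rfl fun x _ => ?_
  by_cases h : X x = s
  · simp only [h, if_true]; simp_rw [cp_swap μ Z _ x]; exact cp_sum hμ Z x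
  · simp [h]

theorem cp_isP {μ : Ω → ℝ} (hμ : IsP μ) (Z : Ω → T) : IsP (cp μ Z) :=
  ⟨cp_nonneg hμ.nn Z, by rw [Fintype.sum_prod_type]; simp_rw [cp_sum hμ.nn]; exact hμ.s1⟩

theorem cp_ne {μ : Ω → ℝ} {Z : Ω → T} {x : Ω × Ω} (hx : cp μ Z x ≠ 0) : Z x.1 = Z x.2 := by
  by_contra hne
  exact hx (by simp [cp, hne])

theorem cp_CI {μ : Ω → ℝ} (hμ : ∀ ω, 0 ≤ μ ω) (Z : Ω → T) (X : Ω → S) (Y : Ω → R) :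
    CI (cp μ Z) (fun x => X x.1) (fun x => Y x.2) (fun x => Z x.1) := by
  intro a b z
  have hYZ : law (cp μ Z) (fun x : Ω × Ω => (Y x.2, Z x.1)) = law μ (fun x => (Y x, Z x)) := by
    rw [← cp_snd hμ Z (fun x => (Y x, Z x))]
    exact law_congr (fun ω hω => Prod.ext rfl (cp_ne hω))
  rw [cp_fst hμ Z Z, cp_fst hμ Z (fun x => (X x, Z x)),
    hYZ]
  have key : law (cp μ Z) (fun x => (X x.1, Y x.2, Z x.1)) (a, b, z) =
      law μ (fun x => (X x, Z x)) (a, z) * law μ (fun x => (Y x, Z x)) (b, z) / law μ Z z := by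
    conv_rhs => rw [law, law, Finset.sum_mul_sum, Finset.sum_div]
    rw [law, Fintype.sum_prod_type]
    refine Finset.sum_congr rfl fun x _ => ?_
    rw [Finset.sum_div]
    refine Finset.sum_congr rfl fun y _ => ?_
    simp only [cp, Prod.mk.injEq]
    by_cases h1 : X x = a <;> by_cases h2 : Y y = b <;> by_cases h3 : Z x = z <;>
      by_cases h4 : Z y = z <;> simp [h1, h2, h3, h4]
    exact fun h => absurd h.symm h4
  rw [key]
  by_cases hz : law μ Z z = 0
  · rw [law_eq_zero hμ hz X a]; simp
  · field_simp

theorem H_cp_fst [Fintype S] {μ : Ω → ℝ} (hμ : ∀ ω, 0 ≤ μ ω) (Z : Ω → T) (X : Ω → S) :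
    H (cp μ Z) (fun x => X x.1) = H μ X := by
  rw [H_eq_h, H_eq_h, cp_fst hμ]

theorem H_cp_snd [Fintype S] {μ : Ω → ℝ} (hμ : ∀ ω, 0 ≤ μ ω) (Z : Ω → T) (X : Ω → S) :
    H (cp μ Z) (fun x => X x.2) = H μ X := by
  rw [H_eq_h, H_eq_h, cp_snd hμ]

theorem BSG [Fintype T] (h2 : ∀ x : G, x + x = 0) {μ : Ω → ℝ} (hμ : IsP μ) (A B : Ω → G)
    (S : Ω → T) :
    H (cp μ (fun ω => (A ω + B ω, S ω))) (fun x => (A x.1 + B x.2, A x.1 + B x.1, S x.1))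
      ≤ 2 * H μ (fun ω => (A ω, S ω)) + 2 * H μ (fun ω => (B ω, S ω)) +
        2 * H μ (fun ω => (A ω + B ω, S ω)) - 3 * H μ S - 2 * H μ (fun ω => (A ω, B ω, S ω)) := by
  set Z : Ω → G × T := fun ω => (A ω + B ω, S ω) with hZ
  set ν := cp μ Z with hν
  have nn := cp_nonneg hμ.nn Z
  have hS : ∀ x, ν x ≠ 0 → S x.1 = S x.2 := fun x hx => (Prod.ext_iff.1 (cp_ne hx)).2
  have hAB : ∀ x, ν x ≠ 0 → A x.1 + B x.1 = A x.2 + B x.2 :=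
    fun x hx => (Prod.ext_iff.1 (cp_ne hx)).1
  have hAB' : ∀ x, ν x ≠ 0 → A x.1 + B x.2 = B x.1 + A x.2 := by
    intro x hx
    have e := hAB x hx
    have : A x.1 = A x.2 + B x.2 - B x.1 := by rw [← e]; simp
    rw [this]
    have e1 : A x.2 + B x.2 - B x.1 + B x.2 = B x.1 + A x.2 + (B x.2 + B x.2) - (B x.1 + B x.1) := by
      abel
    rw [e1, h2, h2]; simp
  have i1 := submod nn (fun x : Ω × Ω => A x.1 + B x.2) (fun x => A x.1 + B x.1) (fun x => S x.1)
  have i2 := submod nn (fun x : Ω × Ω => A x.1) (fun x => B x.1) (fun x => (A x.1 + B x.2, S x.1))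
  have i3 := submod nn (fun x : Ω × Ω => A x.1) (fun x => B x.2) (fun x => S x.1)
  have i4 := submod nn (fun x : Ω × Ω => B x.1) (fun x => A x.2) (fun x => S x.1)
  have e3 : H ν (fun x : Ω × Ω => (A x.1, (A x.1 + B x.2, S x.1))) =
      H ν (fun x : Ω × Ω => (A x.1, B x.2, S x.1)) := by
    refine H_congr nn _ _ fun x y hx hy => ?_
    simp only [Prod.mk.injEq]
    constructor
    · rintro ⟨h1, h2, h3⟩; rw [h1] at h2; exact ⟨h1, by simpa using h2, h3⟩
    · rintro ⟨h1, h2, h3⟩; exact ⟨h1, by rw [h1, h2], h3⟩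
  have e4 : H ν (fun x : Ω × Ω => (B x.1, (A x.1 + B x.2, S x.1))) =
      H ν (fun x : Ω × Ω => (B x.1, A x.2, S x.1)) := by
    refine H_congr nn _ _ fun x y hx hy => ?_
    simp only [Prod.mk.injEq]
    rw [hAB' x hx, hAB' y hy]
    constructor
    · rintro ⟨h1, h2, h3⟩; rw [h1] at h2; exact ⟨h1, by simpa using h2, h3⟩
    · rintro ⟨h1, h2, h3⟩; exact ⟨h1, by rw [h1, h2], h3⟩
  have ci := (cp_CI hμ.nn Z (fun ω => (A ω, B ω, S ω)) (fun ω => (A ω, B ω, S ω))).H_eq nn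
  have e5 : H ν (fun x : Ω × Ω => (A x.1, B x.1, (A x.1 + B x.2, S x.1))) =
      H ν (fun x => ((A x.1, B x.1, S x.1), (A x.2, B x.2, S x.2), Z x.1)) := by
    refine H_congr nn _ _ fun x y hx hy => ?_
    simp only [Prod.mk.injEq, hZ]
    constructor
    · rintro ⟨h1, h2, h3, h4⟩
      have h5 : B x.2 = B y.2 := by rw [h1] at h3; simpa using h3
      have h6 : A x.2 = A y.2 := by
        have ex := hAB x hx
        rw [h1, h2, hAB y hy, h5] at ex
        simpa using ex.symm
      exact ⟨⟨h1, h2, h4⟩, ⟨h6, h5, by rw [← hS x hx, ← hS y hy, h4]⟩, by rw [h1, h2], h4⟩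
    · rintro ⟨⟨h1, h2, h3⟩, ⟨h4, h5, h6⟩, h7, h8⟩
      exact ⟨h1, h2, by rw [h1, h5], h3⟩
  have f1 : ∀ X : Ω → G, H ν (fun x => (X x.1, S x.1)) = H μ (fun ω => (X ω, S ω)) :=
    fun X => H_cp_fst hμ.nn Z (fun ω => (X ω, S ω))
  have f2 : ∀ X : Ω → G, H ν (fun x => (X x.2, S x.1)) = H μ (fun ω => (X ω, S ω)) := by
    intro X
    rw [← H_cp_snd hμ.nn Z (fun ω => (X ω, S ω))]
    refine H_congr nn _ _ fun x y hx hy => ?_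
    rw [hS x hx, hS y hy]
  have f3 : H ν (fun x => S x.1) = H μ S := H_cp_fst hμ.nn Z S
  have f4 : H ν (fun x => Z x.1) = H μ Z := H_cp_fst hμ.nn Z Z
  have f5 : H ν (fun x => ((A x.1, B x.1, S x.1), Z x.1)) = H μ (fun ω => (A ω, B ω, S ω)) := by
    rw [← H_cp_fst hμ.nn Z (fun ω => (A ω, B ω, S ω))]
    refine H_congr nn _ _ fun x y hx hy => ?_
    simp only [Prod.mk.injEq, hZ]
    constructor
    · rintro ⟨h, -⟩; exact h
    · rintro ⟨h1, h2, h3⟩; exact ⟨⟨h1, h2, h3⟩, by rw [h1, h2], h3⟩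
  have f6 : H ν (fun x => ((A x.2, B x.2, S x.2), Z x.1)) = H μ (fun ω => (A ω, B ω, S ω)) := by
    rw [← H_cp_snd hμ.nn Z (fun ω => (A ω, B ω, S ω))]
    refine H_congr nn _ _ fun x y hx hy => ?_
    rw [cp_ne hx, cp_ne hy]
    simp only [Prod.mk.injEq, hZ]
    constructor
    · rintro ⟨h, -⟩; exact h
    · rintro ⟨h1, h2, h3⟩; exact ⟨⟨h1, h2, h3⟩, by rw [h1, h2], h3⟩
  have g1 := f1 A
  have g2 := f1 B
  have g3 := f2 A
  have g4 := f2 B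
  have g5 : H ν (fun x => (A x.1 + B x.1, S x.1)) = H μ Z := f4
  linarith

end
end PFRx

set_option linter.unusedSectionVars false
set_option linter.unusedVariables false
namespace PFRx
section
open Classical Finset Real

variable {Ω Ω' S T R : Type} [Fintype Ω] [Fintype Ω']
variable {G : Type} [AddCommGroup G] [Fintype G]

noncomputable def F (p0 q0 : G → ℝ) (a b : G → ℝ) : ℝ :=
  h (conv a b) - (21/40) * h a - (21/40) * h b + (1/20) * h (conv p0 a) + (1/20) * h (conv q0 b)

theorem continuous_h [Fintype S] : Continuous (h : (S → ℝ) → ℝ) := by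
  unfold h
  exact continuous_finsetSum _ fun x _ => Real.continuous_negMulLog.comp (continuous_apply x)

theorem continuous_conv : Continuous (fun x : (G → ℝ) × (G → ℝ) => conv x.1 x.2) := by
  unfold conv
  fun_prop

theorem continuous_F (p0 q0 : G → ℝ) :
    Continuous (fun x : (G → ℝ) × (G → ℝ) => F p0 q0 x.1 x.2) := by
  have c1 : Continuous fun x : (G → ℝ) × (G → ℝ) => h (conv x.1 x.2) :=
    continuous_h.comp continuous_conv
  have c2 : Continuous fun x : (G → ℝ) × (G → ℝ) => h x.1 := continuous_h.comp continuous_fst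
  have c3 : Continuous fun x : (G → ℝ) × (G → ℝ) => h x.2 := continuous_h.comp continuous_snd
  have c4 : Continuous fun x : (G → ℝ) × (G → ℝ) => h (conv p0 x.1) :=
    c1.comp ((continuous_const (y := p0)).prodMk continuous_fst)
  have c5 : Continuous fun x : (G → ℝ) × (G → ℝ) => h (conv q0 x.2) :=
    c1.comp ((continuous_const (y := q0)).prodMk continuous_snd)
  unfold F
  exact ((((c1.sub (c2.const_mul _)).sub (c3.const_mul _)).add (c4.const_mul _)).add
      (c5.const_mul _))

theorem mem_simplex (p : G → ℝ) : p ∈ stdSimplex ℝ G ↔ IsP p :=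
  ⟨fun h => ⟨h.1, h.2⟩, fun h => ⟨h.nn, h.s1⟩⟩

theorem exists_min {p0 q0 : G → ℝ} (hp0 : IsP p0) (hq0 : IsP q0) :
    ∃ p q, IsP p ∧ IsP q ∧ ∀ a b, IsP a → IsP b → F p0 q0 p q ≤ F p0 q0 a b := by
  have hc : IsCompact (stdSimplex ℝ G ×ˢ stdSimplex ℝ G) :=
    (isCompact_stdSimplex ℝ G).prod (isCompact_stdSimplex ℝ G)
  have hne : (stdSimplex ℝ G ×ˢ stdSimplex ℝ G).Nonempty :=
    ⟨(p0, q0), Set.mk_mem_prod ((mem_simplex p0).2 hp0) ((mem_simplex q0).2 hq0)⟩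
  obtain ⟨x, hx, hmin⟩ := hc.exists_isMinOn hne (continuous_F p0 q0).continuousOn
  rw [Set.mem_prod, mem_simplex, mem_simplex] at hx
  rw [isMinOn_iff] at hmin
  refine ⟨x.1, x.2, hx.1, hx.2, fun a b ha hb => ?_⟩
  exact hmin (a, b) (Set.mk_mem_prod ((mem_simplex a).2 ha) ((mem_simplex b).2 hb))

theorem avg_min [Fintype T] {p0 q0 : G → ℝ} (hp0 : IsP p0) (hq0 : IsP q0) {C : ℝ}
    (hC : ∀ a b, IsP a → IsP b → C ≤ F p0 q0 a b) {μ : Ω → ℝ} (hμ : IsP μ) {A B : Ω → G}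
    {Z : Ω → T} (hc : CI μ A B Z) :
    C ≤ (H μ (fun ω => (A ω + B ω, Z ω)) - H μ Z) - (21/40) * (H μ (fun ω => (A ω, Z ω)) - H μ Z)
      - (21/40) * (H μ (fun ω => (B ω, Z ω)) - H μ Z) + (1/20) * h (conv p0 (law μ A))
      + (1/20) * h (conv q0 (law μ B)) := by
  have i1 := avg_conv_le hμ hp0 A Z
  have i2 := avg_conv_le hμ hq0 B Z
  have e1 := avg_h hμ A Z
  have e2 := avg_h hμ B Z
  have e3 := avg_h hμ (fun ω => A ω + B ω) Z
  have hs : ∑ z, law μ Z z * C = C := by rw [← Finset.sum_mul, sum_law, hμ.s1, one_mul]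
  have : ∑ z, law μ Z z * C ≤ ∑ z, (law μ Z z * h (cl μ (fun ω => A ω + B ω) Z z)
      - (21/40) * (law μ Z z * h (cl μ A Z z)) - (21/40) * (law μ Z z * h (cl μ B Z z))
      + (1/20) * (law μ Z z * h (conv p0 (cl μ A Z z)))
      + (1/20) * (law μ Z z * h (conv q0 (cl μ B Z z)))) := by
    refine Finset.sum_le_sum fun z _ => ?_
    by_cases hz : law μ Z z = 0
    · simp [hz]
    have := hC _ _ (hμ.cl A Z hz) (hμ.cl B Z hz)
    unfold F at this
    rw [conv_cl hc hz] at this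
    have := mul_le_mul_of_nonneg_left this (law_nonneg hμ.nn Z z)
    linarith
  simp only [Finset.sum_sub_distrib, Finset.sum_add_distrib, ← Finset.mul_sum] at this
  linarith

theorem H_four {y1 y2 y3 y4 : G → ℝ} (p1 : IsP y1) (p2 : IsP y2) (p3 : IsP y3) (p4 : IsP y4) :
    H (pm (pm y1 y2) (pm y3 y4)) (fun x => (x.1.1 + x.1.2, x.2.1 + x.2.2)) =
      h (conv y1 y2) + h (conv y3 y4) := by
  rw [← H_add, ← H_add, ← H_pm (p1.pm p2).nn (p3.pm p4).nn (p1.pm p2).s1 (p3.pm p4).s1]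

noncomputable def J (y1 y2 y3 y4 : G → ℝ) : ℝ :=
  H (pm (pm y1 y2) (pm y3 y4)) (fun x => (x.1.1 + x.2.1, x.1.1 + x.1.2, x.2.1 + x.2.2))

theorem fibre {p0 q0 : G → ℝ} (hp0 : IsP p0) (hq0 : IsP q0) {C : ℝ}
    (hC : ∀ a b, IsP a → IsP b → C ≤ F p0 q0 a b)
    {y1 y2 y3 y4 : G → ℝ} (p1 : IsP y1) (p2 : IsP y2) (p3 : IsP y3) (p4 : IsP y4) :
    2 * C ≤ h (conv (conv y1 y2) (conv y3 y4)) + J y1 y2 y3 y4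
      - h (conv y1 y2) - h (conv y3 y4) - (21/40) * (h y1 + h y2 + h y3 + h y4)
      + (1/20) * (h (conv p0 (conv y1 y2)) + h (conv p0 y1) + h (conv q0 (conv y3 y4))
        + h (conv q0 y3)) := by
  have i1 := hC _ _ (p1.conv p2) (p3.conv p4)
  unfold F at i1
  have q12 := p1.pm p2
  have q34 := p3.pm p4
  have hP := q12.pm q34
  have i2 := avg_min hp0 hq0 hC hP (CI_pm (pm y1 y2) (pm y3 y4) (fun x => x.1)
    (fun x => x.1 + x.2) (fun x => x.1) (fun x => x.1 + x.2))
  have e1 : law (pm (pm y1 y2) (pm y3 y4)) (fun x => x.1.1) = y1 := by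
    rw [law_pm_fst _ q34.s1 (fun x : G × G => x.1), law_pm_fst _ p2.s1 (fun x => x), law_id]
  have e2 : law (pm (pm y1 y2) (pm y3 y4)) (fun x => x.2.1) = y3 := by
    rw [law_pm_snd _ q12.s1 (fun x : G × G => x.1), law_pm_fst _ p4.s1 (fun x => x), law_id]
  have e3 := H_four p1 p2 p3 p4
  have e4 : H (pm (pm y1 y2) (pm y3 y4)) (fun x => (x.1.1, x.1.1 + x.1.2, x.2.1 + x.2.2)) =
      h y1 + h y2 + h (conv y3 y4) := by
    rw [← H_add, ← H_id y1, ← H_id y2, ← H_pm p1.nn p2.nn p1.s1 p2.s1,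
      ← H_pm q12.nn q34.nn q12.s1 q34.s1]
    refine H_congr hP.nn _ _ ?_
    rintro ⟨⟨a, b⟩, c⟩ ⟨⟨a', b'⟩, c'⟩ _ _
    simp only [Prod.mk.injEq]
    constructor
    · rintro ⟨rfl, h, h'⟩; exact ⟨⟨rfl, by simpa using h⟩, h'⟩
    · rintro ⟨⟨rfl, rfl⟩, h⟩; exact ⟨rfl, rfl, h⟩
  have e5 : H (pm (pm y1 y2) (pm y3 y4)) (fun x => (x.2.1, x.1.1 + x.1.2, x.2.1 + x.2.2)) =
      h (conv y1 y2) + (h y3 + h y4) := by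
    rw [← H_add, ← H_id y3, ← H_id y4, ← H_pm p3.nn p4.nn p3.s1 p4.s1,
      ← H_pm q12.nn q34.nn q12.s1 q34.s1]
    refine H_congr hP.nn _ _ ?_
    rintro ⟨c, ⟨a, b⟩⟩ ⟨c', ⟨a', b'⟩⟩ _ _
    simp only [Prod.mk.injEq]
    constructor
    · rintro ⟨rfl, h, h'⟩; exact ⟨h, ⟨rfl, by simpa using h'⟩⟩
    · rintro ⟨h, ⟨rfl, rfl⟩⟩; exact ⟨rfl, h, rfl⟩
  rw [e1, e2, e3, e4, e5] at i2
  unfold J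
  linarith

theorem main_k {p0 q0 : G → ℝ} (h2 : ∀ x : G, x + x = 0) (hp0 : IsP p0) (hq0 : IsP q0)
    {p q : G → ℝ} (hp : IsP p) (hq : IsP q)
    (hC : ∀ a b, IsP a → IsP b → F p0 q0 p q ≤ F p0 q0 a b) :
    h (conv p q) - h p / 2 - h q / 2 ≤ 0 := by
  have f1 := fibre hp0 hq0 hC hp hq hq hp
  have f2 := fibre hp0 hq0 hC hp hp hq hq
  set μ := pm (pm p p) (pm q q) with hμ
  have hP : IsP μ := (hp.pm hp).pm (hq.pm hq)
  -- coordinates: x.1.1 = X1, x.1.2 = X1', x.2.1 = X2, x.2.2 = X2'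
  set A : (G × G) × (G × G) → G := fun x => x.1.1 + x.2.1 with hA
  set B : (G × G) × (G × G) → G := fun x => x.1.2 + x.2.1 with hB
  set SS : (G × G) × (G × G) → G := fun x => (x.1.1 + x.1.2) + (x.2.1 + x.2.2) with hSS
  have hAB : ∀ x, A x + B x = x.1.1 + x.1.2 := by
    intro x
    simp only [hA, hB]
    calc x.1.1 + x.2.1 + (x.1.2 + x.2.1) = x.1.1 + x.1.2 + (x.2.1 + x.2.1) := by abel
      _ = _ := by rw [h2, add_zero]
  have bsg := BSG h2 hP A B SS
  have am := avg_min hp0 hq0 hC (cp_isP hP (fun ω => (A ω + B ω, SS ω)))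
    (cp_CI hP.nn (fun ω => (A ω + B ω, SS ω)) A B)
  rw [H_cp_fst hP.nn (fun ω => (A ω + B ω, SS ω)) (fun ω => (A ω + B ω, SS ω)),
    H_cp_fst hP.nn (fun ω => (A ω + B ω, SS ω)) (fun ω => (A ω, (A ω + B ω, SS ω))),
    cp_fst hP.nn, cp_snd hP.nn] at am
  have t1 : H (cp μ (fun ω => (A ω + B ω, SS ω))) (fun ω => (B ω.2, (A ω.1 + B ω.1, SS ω.1))) =
      H μ (fun ω => (B ω, (A ω + B ω, SS ω))) := by
    rw [← H_cp_snd hP.nn (fun ω => (A ω + B ω, SS ω)) (fun ω => (B ω, (A ω + B ω, SS ω)))]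
    refine H_congr (cp_isP hP _).nn _ _ fun x y hx hy => ?_
    rw [cp_ne hx, cp_ne hy]
  rw [t1] at am
  have swap4 : ∀ (y1 y2 y3 y4 : G → ℝ), (fun ω => pm (pm y1 y3) (pm y2 y4)
      ((Equiv.prodProdProdComm G G G G) ω)) = pm (pm y1 y2) (pm y3 y4) := by
    intro y1 y2 y3 y4
    ext x; simp [pm]; ring
  have lA : law μ A = conv p q := by
    have := law_equiv (Equiv.prodProdProdComm G G G G) (pm (pm p q) (pm p q)) (fun x => x.1.1 + x.1.2)
    rw [swap4, law_pm_fst _ (hp.pm hq).s1 (fun x : G × G => x.1 + x.2), ← conv_eq_law] at this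
    exact this
  let e' : (G × G) × (G × G) ≃ (G × G) × (G × G) :=
    (Equiv.prodCongr (Equiv.prodComm G G) (Equiv.refl _))
  have swap12 : ∀ (y1 y2 y3 y4 : G → ℝ), (fun ω => pm (pm y2 y1) (pm y3 y4) (e' ω)) =
      pm (pm y1 y2) (pm y3 y4) := by
    intro y1 y2 y3 y4
    ext x; change y2 x.1.2 * y1 x.1.1 * (y3 x.2.1 * y4 x.2.2) = y1 x.1.1 * y2 x.1.2 * (y3 x.2.1 * y4 x.2.2); ring
  have lB : law μ B = conv p q := by
    rw [← lA]
    have := law_equiv e' μ A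
    rw [swap12] at this
    exact this
  -- H(A,S), H(B,S), H(A+B,S), H S
  have hS : H μ SS = h (conv (conv p p) (conv q q)) := by
    rw [H_eq_h, law_pm_add (pm p p) (pm q q) (fun x : G × G => x.1 + x.2) (fun x : G × G => x.1 + x.2),
      ← conv_eq_law, ← conv_eq_law]
  have hAS : H μ (fun ω => (A ω, SS ω)) = 2 * h (conv p q) := by
    have e1 := H_four hp hq hp hq
    rw [← H_equiv (Equiv.prodProdProdComm G G G G), swap4] at e1
    have e2 : H μ (fun ω => (A ω, SS ω)) = h (conv p q) + h (conv p q) := by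
      rw [← e1]
      refine H_congr hP.nn _ _ ?_
      rintro ⟨⟨a, b⟩, ⟨c, d⟩⟩ ⟨⟨a', b'⟩, ⟨c', d'⟩⟩ _ _
      simp only [Prod.mk.injEq, hA, hSS, Equiv.prodProdProdComm_apply]
      constructor
      · rintro ⟨h, h'⟩
        refine ⟨h, ?_⟩
        rw [add_add_add_comm, add_add_add_comm a', h] at h'
        simpa using h'
      · rintro ⟨h, h'⟩
        refine ⟨h, ?_⟩
        rw [add_add_add_comm, add_add_add_comm a', h, h']
    linarith
  have hBS : H μ (fun ω => (B ω, SS ω)) = 2 * h (conv p q) := by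
    rw [← hAS]
    have := H_equiv e' μ (fun ω => (A ω, SS ω))
    rw [swap12] at this
    rw [← this]
    refine H_congr hP.nn _ _ ?_
    rintro ⟨⟨a, b⟩, ⟨c, d⟩⟩ ⟨⟨a', b'⟩, ⟨c', d'⟩⟩ _ _
    simp [hA, hB, hSS, e', add_comm a b, add_comm a' b']
  have hWS : H μ (fun ω => (A ω + B ω, SS ω)) = h (conv p p) + h (conv q q) := by
    rw [← H_four hp hp hq hq]
    refine H_congr hP.nn _ _ ?_
    intro x y _ _
    simp only [hAB, Prod.mk.injEq, hSS]
    constructor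
    · rintro ⟨h, h'⟩; rw [h] at h'; exact ⟨h, by simpa using h'⟩
    · rintro ⟨h, h'⟩; exact ⟨h, by rw [h, h']⟩
  have J2 : J p p q q = H μ (fun ω => (A ω, B ω, SS ω)) := by
    refine H_congr hP.nn _ _ ?_
    intro x y _ _
    have hx := hAB x
    have hy := hAB y
    simp only [Prod.mk.injEq]
    constructor
    · rintro ⟨h, h', h''⟩
      rw [← hx, ← hy, show A x = A y from h] at h'
      refine ⟨h, by simpa using h', ?_⟩
      simp only [hSS]; rw [← hx, ← hy, show A x = A y from h, h', h'']
    · rintro ⟨h, h', h''⟩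
      refine ⟨h, by rw [← hx, ← hy, h, h'], ?_⟩
      simp only [hSS] at h''; rw [← hx, ← hy, h, h'] at h''
      simpa using h''
  have J3 : H μ (fun ω => (A ω, (A ω + B ω, SS ω))) = H μ (fun ω => (A ω, B ω, SS ω)) := by
    refine H_congr hP.nn _ _ ?_
    intro x y _ _
    simp only [Prod.mk.injEq]
    constructor
    · rintro ⟨h, h', h''⟩; rw [h] at h'; exact ⟨h, by simpa using h', h''⟩
    · rintro ⟨h, h', h''⟩; exact ⟨h, by rw [h, h'], h''⟩
  have J4 : H μ (fun ω => (B ω, (A ω + B ω, SS ω))) = H μ (fun ω => (A ω, B ω, SS ω)) := by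
    refine H_congr hP.nn _ _ ?_
    intro x y _ _
    simp only [Prod.mk.injEq]
    constructor
    · rintro ⟨h, h', h''⟩; rw [h] at h'; exact ⟨by simpa using h', h, h''⟩
    · rintro ⟨h, h', h''⟩; exact ⟨h', by rw [h, h'], h''⟩
  have J1 : J p q q p = H μ (fun ω => (A ω, B ω, SS ω)) := by
    -- (X1, X2', X2, X1')
    let e : (G × G) × (G × G) ≃ (G × G) × (G × G) :=
      { toFun := fun x => ((x.1.1, x.2.2), (x.2.1, x.1.2))
        invFun := fun x => ((x.1.1, x.2.2), (x.2.1, x.1.2))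
        left_inv := fun x => rfl
        right_inv := fun x => rfl }
    unfold J
    rw [← H_equiv e]
    have : (fun ω => pm (pm p q) (pm q p) (e ω)) = μ := by
      ext x; change p x.1.1 * q x.2.2 * (q x.2.1 * p x.1.2) = p x.1.1 * p x.1.2 * (q x.2.1 * q x.2.2); ring
    rw [this]
    refine H_congr hP.nn _ _ ?_
    rintro ⟨⟨a, b⟩, ⟨c, d⟩⟩ ⟨⟨a', b'⟩, ⟨c', d'⟩⟩ _ _
    simp only [Prod.mk.injEq, hA, hB, hSS, e, Equiv.coe_fn_mk]
    have k1 : ∀ a b c d : G, a + b + (c + d) = (a + d) + (c + b) := by intros; abel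
    rw [k1 a, k1 a', add_comm b, add_comm b']
    constructor
    · rintro ⟨h, h', h''⟩; exact ⟨h, h'', by rw [h', h'']⟩
    · rintro ⟨h, h', h''⟩; rw [h'] at h''; exact ⟨h, by simpa using h'', h'⟩
  rw [J1] at f1
  rw [J2] at f2
  rw [J3, J4, lA, lB, hWS] at am
  rw [hAS, hBS, hWS, hS] at bsg
  set Jv := H μ (fun ω => (A ω, B ω, SS ω)) with hJv
  have s1 : conv (conv p q) (conv q p) = conv (conv p p) (conv q q) := by
    rw [conv_comm q p, conv_assoc, ← conv_assoc q p q, conv_comm q p, conv_assoc p q q,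
      ← conv_assoc]
  rw [s1, conv_comm q p] at f1
  -- KV bounds
  have k1 := KV hp0 hp hq
  rw [conv_assoc] at k1
  have k2 := KV hq0 hq hp
  rw [conv_assoc, conv_comm q p] at k2
  have k3 := KV hp0 hp hp
  rw [conv_assoc] at k3
  have k4 := KV hq0 hq hq
  rw [conv_assoc] at k4
  have k5 := KV hp hq hp
  have k6 := KV hq hp hq
  rw [conv_comm q p] at k5 k6
  have k7 : h (conv p p) ≤ h (conv (conv p q) p) := by
    rw [conv_comm p q, conv_assoc]; exact h_conv_ge hq (hp.conv hp)
  have k8 : h (conv q q) ≤ h (conv (conv p q) q) := by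
    rw [conv_assoc]; exact h_conv_ge hp (hq.conv hq)
  have k9 : h (conv (conv p p) (conv q q)) + h p ≤ h (conv p q) + h (conv (conv p q) p) := by
    have := KV (hp.conv hq) hp hq
    have e : conv (conv (conv p q) p) q = conv (conv p p) (conv q q) := by
      rw [← s1, conv_assoc (conv p q), conv_comm p q]
    rw [e] at this
    linarith
  unfold F at f1 f2 am
  have hAm : H (cp μ fun ω => (A ω + B ω, SS ω)) (fun ω => (A ω.1 + B ω.2, A ω.1 + B ω.1, SS ω.1))
    = H (cp μ fun ω => (A ω + B ω, SS ω)) (fun x => (A x.1 + B x.2, A x.1 + B x.1, SS x.1)) := rfl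
  have m1 := h_conv_ge hp hq
  have m2 := h_conv_ge' hp hq
  linarith

theorem stab {p : G → ℝ} (h2 : ∀ x : G, x + x = 0) (hp : IsP p) (hk : h (conv p p) ≤ h p) :
    ∃ (V : AddSubgroup G) (a : G), ∀ x, p x = if x - a ∈ V then 1 / (Nat.card V : ℝ) else 0 := by
  have hsub : ∀ x y : G, x - y = x + y := fun x y => by
    rw [sub_eq_iff_eq_add, add_assoc, h2, add_zero]
  have jen : ∀ z, ∑ x, p x * negMulLog (p (z - x)) ≤ negMulLog (conv p p z) := by
    intro z
    have := Real.concaveOn_negMulLog.le_map_sum (t := Finset.univ) (w := p)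
      (p := fun x => p (z - x)) (fun i _ => hp.nn i) hp.s1 (fun i _ => hp.nn _)
    simpa [conv, smul_eq_mul] using this
  have tot : ∑ z, ∑ x, p x * negMulLog (p (z - x)) = h p := by
    rw [Finset.sum_comm]
    simp_rw [← Finset.mul_sum]
    have : ∀ x, ∑ z, negMulLog (p (z - x)) = h p := fun x =>
      Equiv.sum_comp (Equiv.subRight x) (fun z => negMulLog (p z))
    simp_rw [this]
    rw [← Finset.sum_mul, hp.s1, one_mul]
  have eqz : ∀ z, ∑ x, p x * negMulLog (p (z - x)) = negMulLog (conv p p z) := by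
    have := (Finset.sum_eq_sum_iff_of_le (s := Finset.univ) (fun z _ => jen z)).1
      (le_antisymm (Finset.sum_le_sum fun z _ => jen z) (by rw [tot]; exact hk))
    exact fun z => this z (Finset.mem_univ _)
  have const : ∀ z x, p x ≠ 0 → p (z - x) = conv p p z := by
    intro z x hx
    have := (Real.strictConcaveOn_negMulLog.map_sum_eq_iff' (t := Finset.univ) (w := p)
      (p := fun x => p (z - x)) (fun i _ => hp.nn i) hp.s1 (fun i _ => hp.nn _)).1
        (by simpa [conv, smul_eq_mul] using (eqz z).symm)
    have := this x (Finset.mem_univ _) hx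
    simpa [conv, smul_eq_mul] using this
  let V : AddSubgroup G :=
    { carrier := {v | ∀ x, p (x + v) = p x}
      zero_mem' := by intro x; simp
      add_mem' := by
        intro a b ha hb x
        rw [← add_assoc, hb, ha]
      neg_mem' := by
        intro a ha x
        have := ha (x + -a)
        simpa using this.symm }
  have hV : ∀ v, v ∈ V ↔ ∀ x, p (x + v) = p x := fun v => Iff.rfl
  obtain ⟨a, ha⟩ : ∃ a, p a ≠ 0 := by
    by_contra! h0
    have := hp.s1
    simp [h0] at this
  have key : ∀ x, x - a ∈ V ↔ p x ≠ 0 := by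
    intro x
    constructor
    · intro hx
      have := (hV _).1 hx a
      rw [add_sub_cancel] at this
      rw [this]; exact ha
    · intro hx
      rw [hV]
      intro y
      have h1 := const (y + x) x hx
      have h3 := const (y + x) a ha
      rw [add_sub_cancel_right] at h1
      rw [h1, ← h3]; congr 1; abel
  have val : ∀ x, x - a ∈ V → p x = p a := by
    intro x hx
    have := (hV _).1 hx a
    rwa [add_sub_cancel] at this
  refine ⟨V, a, ?_⟩
  have card : (Nat.card V : ℝ) * p a = 1 := by
    rw [← hp.s1, ← Equiv.sum_comp (Equiv.addRight a)]
    have : ∀ x, p ((Equiv.addRight a) x) = if x ∈ V then p a else 0 := by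
      intro x
      simp only [Equiv.coe_addRight]
      split_ifs with hx
      · exact val _ (by simpa using hx)
      · by_contra hne
        have := (key _).2 hne
        simp at this
        exact hx this
    simp_rw [this]
    rw [← Finset.sum_filter, Finset.sum_const, nsmul_eq_mul, Nat.card_eq_fintype_card,
      Fintype.card_subtype]
  intro x
  split_ifs with hx
  · rw [val x hx, eq_div_iff, mul_comm, card]
    intro h0; rw [h0] at card; simp at card
  · by_contra hne; exact hx ((key x).2 hne)

theorem pfr_ent (h2 : ∀ x : G, x + x = 0) {p0 q0 : G → ℝ} (hp0 : IsP p0) (hq0 : IsP q0) :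
    ∃ (V : AddSubgroup G) (a : G) (p : G → ℝ), IsP p ∧
      (∀ x, p x = if x - a ∈ V then 1 / (Nat.card V : ℝ) else 0) ∧
      h (conv p0 p) - h p0 / 2 - h p / 2 ≤ 22 * (h (conv p0 q0) - h p0 / 2 - h q0 / 2) := by
  obtain ⟨p, q, hp, hq, hmin⟩ := exists_min hp0 hq0
  have hk := main_k h2 hp0 hq0 hp hq hmin
  have m1 := h_conv_ge hp hq
  have m2 := h_conv_ge' hp hq
  have k5 := KV hp hq hp
  have k7 : h (conv p p) ≤ h (conv (conv p q) p) := by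
    rw [conv_comm p q, conv_assoc]; exact h_conv_ge hq (hp.conv hp)
  rw [conv_comm q p] at k5
  obtain ⟨V, a, hV⟩ := stab h2 hp (by linarith)
  refine ⟨V, a, p, hp, hV, ?_⟩
  have := hmin q0 p0 hq0 hp0
  unfold F at this
  rw [conv_comm q0 p0] at this
  have n1 := h_conv_ge hq0 hq
  have n2 := h_conv_ge' hq0 hq
  linarith

end
end PFRx

set_option linter.unusedSectionVars false
set_option linter.unusedVariables false
namespace PFRx
section
open Classical Finset Real

variable {Ω Ω' S T R : Type} [Fintype Ω] [Fintype Ω']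
variable {G : Type} [AddCommGroup G] [Fintype G]

theorem h_le_log [Fintype S] {p : S → ℝ} (hp : IsP p) (t : Finset S)
    (ht : ∀ x, p x ≠ 0 → x ∈ t) : h p ≤ Real.log (t.card : ℝ) := by
  have e : ∀ f : S → ℝ, (∀ x, p x = 0 → f x = 0) → ∑ x, f x = ∑ x ∈ t, f x := by
    intro f hf
    symm
    refine Finset.sum_subset (Finset.subset_univ _) fun x _ hx => hf x ?_
    by_contra h0; exact hx (ht x h0)
  have s1 : ∑ x ∈ t, p x = 1 := by rw [← e p (fun x hx => hx), hp.s1]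
  have hne : t.Nonempty := by
    by_contra h0
    rw [Finset.not_nonempty_iff_eq_empty] at h0
    rw [h0] at s1; simp at s1
  have hN : (0:ℝ) < t.card := by exact_mod_cast hne.card_pos
  unfold h
  rw [e _ (fun x hx => by rw [hx]; simp)]
  have : ∀ x ∈ t, negMulLog (p x) ≤ p x * Real.log t.card + (1 / (t.card : ℝ) - p x) := by
    intro x _
    by_cases h0 : p x = 0
    · rw [h0]; simp
    have hpos : 0 < p x := lt_of_le_of_ne (hp.nn x) (Ne.symm h0)
    have l := Real.log_le_sub_one_of_pos (x := 1 / (t.card * p x)) (by positivity)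
    rw [Real.log_div one_ne_zero (by positivity), Real.log_mul hN.ne' h0, Real.log_one] at l
    have l2 := mul_le_mul_of_nonneg_left l hpos.le
    have : p x * (1 / (t.card * p x) - 1) = 1 / (t.card : ℝ) - p x := by field_simp
    rw [this] at l2
    unfold negMulLog
    linarith
  refine (Finset.sum_le_sum this).trans ?_
  rw [Finset.sum_add_distrib, Finset.sum_sub_distrib, ← Finset.sum_mul, s1, Finset.sum_const,
    nsmul_eq_mul]
  rw [mul_one_div_cancel hN.ne']; linarith

theorem law_supp {μ : Ω → ℝ} {X : Ω → S} {s : S} (hs : law μ X s ≠ 0) :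
    ∃ ω, μ ω ≠ 0 ∧ X ω = s := by
  obtain ⟨ω, _, hω⟩ := Finset.exists_ne_zero_of_sum_ne_zero hs
  refine ⟨ω, ?_⟩
  by_cases h1 : X ω = s
  · simp [h1] at hω; exact ⟨hω, h1⟩
  · simp [h1] at hω

theorem cl_supp {μ : Ω → ℝ} {X : Ω → S} {Z : Ω → T} {z : T} {s : S} (hs : cl μ X Z z s ≠ 0) :
    ∃ ω, μ ω ≠ 0 ∧ X ω = s ∧ Z ω = z := by
  have : law μ (fun ω => (X ω, Z ω)) (s, z) ≠ 0 := by
    intro h0; apply hs; unfold cl; rw [h0, zero_div]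
  obtain ⟨ω, h1, h2⟩ := law_supp this
  simp only [Prod.mk.injEq] at h2
  exact ⟨ω, h1, h2⟩

theorem h_unif [Fintype S] (E : Finset S) (hE : E.Nonempty) {p : S → ℝ}
    (hp : ∀ x, p x = if x ∈ E then 1 / (E.card : ℝ) else 0) :
    IsP p ∧ h p = Real.log E.card := by
  have hN : (0:ℝ) < E.card := by exact_mod_cast hE.card_pos
  refine ⟨⟨fun x => ?_, ?_⟩, ?_⟩
  · rw [hp]; split_ifs <;> positivity
  · simp_rw [hp]
    rw [Finset.sum_ite_mem, Finset.univ_inter, Finset.sum_const, nsmul_eq_mul,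
      mul_one_div_cancel hN.ne']
  · unfold h
    have : ∀ x, negMulLog (p x) = if x ∈ E then negMulLog (1 / (E.card : ℝ)) else 0 := by
      intro x; rw [hp]; split_ifs <;> simp
    simp_rw [this]
    rw [Finset.sum_ite_mem, Finset.univ_inter, Finset.sum_const, nsmul_eq_mul]
    unfold negMulLog
    rw [Real.log_div one_ne_zero hN.ne', Real.log_one]
    field_simp; ring

theorem comb (h2 : ∀ x : G, x + x = 0) (A : Finset G) (E : Finset (G × G)) (hne : E.Nonempty)
    (hE : ∀ x ∈ E, x.1 ∈ A ∧ x.2 ∈ A ∧ x.1 + x.2 ∈ A) (L : ℝ)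
    (hL : 2 * Real.log A.card - L ≤ Real.log E.card) :
    ∃ (V : AddSubgroup G) (b : G), Real.log (Nat.card V) ≤ Real.log A.card + 176 * L ∧
      Real.log A.card - 180 * L ≤ Real.log ((A.filter fun x => x - b ∈ V).card) ∧
      (A.filter fun x => x - b ∈ V).Nonempty := by
  obtain ⟨hμ, hh⟩ := h_unif E hne (p := fun x => if x ∈ E then 1 / (E.card : ℝ) else 0)
    (fun x => by split_ifs <;> rfl)
  set μ : G × G → ℝ := fun x => if x ∈ E then 1 / (E.card : ℝ) else 0 with hμd
  have sup : ∀ x, μ x ≠ 0 → x ∈ E := by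
    intro x hx; by_contra h0; exact hx (by simp [hμd, h0])
  have bd : ∀ X : G × G → G, (∀ x ∈ E, X x ∈ A) → H μ X ≤ Real.log A.card := by
    intro X hX
    rw [H_eq_h]
    refine h_le_log (hμ.law X) A fun x hx => ?_
    obtain ⟨ω, h1, rfl⟩ := law_supp hx
    exact hX _ (sup _ h1)
  have b1 := bd (fun x => x.1) (fun x hx => (hE x hx).1)
  have b2 := bd (fun x => x.2) (fun x hx => (hE x hx).2.1)
  have b3 := bd (fun x => x.1 + x.2) (fun x hx => (hE x hx).2.2)
  have bsg := BSG h2 hμ (fun x => x.1) (fun x => x.2) (fun _ => ())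
  have d1 : H μ (fun x => (x.1, ())) = H μ (fun x => x.1) :=
    H_congr hμ.nn _ _ (fun x y _ _ => by simp)
  have d2 : H μ (fun x => (x.2, ())) = H μ (fun x => x.2) :=
    H_congr hμ.nn _ _ (fun x y _ _ => by simp)
  have d3 : H μ (fun x => (x.1 + x.2, ())) = H μ (fun x => x.1 + x.2) :=
    H_congr hμ.nn _ _ (fun x y _ _ => by simp)
  have d4 : H μ (fun x => (x.1, x.2, ())) = Real.log E.card := by
    rw [← hh, ← H_id]
    exact H_congr hμ.nn _ _ (fun x y _ _ => by simp [Prod.ext_iff])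
  have d5 : H μ (fun x => (x.1, (x.1 + x.2, ()))) = Real.log E.card := by
    rw [← hh, ← H_id]
    refine H_congr hμ.nn _ _ (fun x y _ _ => ?_)
    simp only [Prod.mk.injEq, Prod.ext_iff, and_true]
    constructor
    · rintro ⟨h, h'⟩; rw [h] at h'; exact ⟨h, by simpa using h'⟩
    · rintro ⟨h, h'⟩; exact ⟨h, by rw [h, h']⟩
  have d6 : H μ (fun x => (x.2, (x.1 + x.2, ()))) = Real.log E.card := by
    rw [← hh, ← H_id]
    refine H_congr hμ.nn _ _ (fun x y _ _ => ?_)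
    simp only [Prod.mk.injEq, Prod.ext_iff, and_true]
    constructor
    · rintro ⟨h, h'⟩; rw [h] at h'; exact ⟨by simpa using h', h⟩
    · rintro ⟨h, h'⟩; exact ⟨h', by rw [h, h']⟩
  rw [d1, d2, d3, d4, H_const hμ.s1] at bsg
  set Z : G × G → G × Unit := fun x => (x.1 + x.2, ()) with hZ
  have hci := cp_CI hμ.nn Z (fun x => x.1) (fun x => x.2)
  have hQ := cp_isP hμ Z
  have a1 := avg_h hQ (fun x => x.1.1) (fun x => Z x.1)
  have a2 := avg_h hQ (fun x => x.2.2) (fun x => Z x.1)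
  have a3 := avg_h hQ (fun x => x.1.1 + x.2.2) (fun x => Z x.1)
  have t1 : H (cp μ Z) (fun ω => (ω.2.2, Z ω.1)) = Real.log E.card := by
    rw [← d6, ← H_cp_snd hμ.nn Z (fun ω => (ω.2, Z ω))]
    refine H_congr hQ.nn _ _ fun x y hx hy => ?_
    rw [cp_ne hx, cp_ne hy]
  rw [H_cp_fst hμ.nn Z (fun x => (x.1, Z x)), H_cp_fst hμ.nn Z Z] at a1
  rw [t1, H_cp_fst hμ.nn Z Z] at a2
  rw [H_cp_fst hμ.nn Z Z] at a3
  have hZ3 : H μ Z = H μ (fun x => x.1 + x.2) := d3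
  have d5' : H μ (fun x => (x.1, Z x)) = Real.log E.card := d5
  have bsg' : H (cp μ Z) (fun x => (x.1.1 + x.2.2, Z x.1)) ≤ _ := bsg
  set W := law (cp μ Z) (fun x => Z x.1) with hW
  have hWP : IsP W := hQ.law _
  have avg : ∑ z, W z * (h (cl (cp μ Z) (fun x => x.1.1 + x.2.2) (fun x => Z x.1) z)
      - h (cl (cp μ Z) (fun x => x.1.1) (fun x => Z x.1) z) / 2
      - h (cl (cp μ Z) (fun x => x.2.2) (fun x => Z x.1) z) / 2
      + (Real.log A.card - h (cl (cp μ Z) (fun x => x.1.1) (fun x => Z x.1) z))) ≤ 4 * L := by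
    have : ∀ z, W z * (h (cl (cp μ Z) (fun x => x.1.1 + x.2.2) (fun x => Z x.1) z)
      - h (cl (cp μ Z) (fun x => x.1.1) (fun x => Z x.1) z) / 2
      - h (cl (cp μ Z) (fun x => x.2.2) (fun x => Z x.1) z) / 2
      + (Real.log A.card - h (cl (cp μ Z) (fun x => x.1.1) (fun x => Z x.1) z))) =
      W z * h (cl (cp μ Z) (fun x => x.1.1 + x.2.2) (fun x => Z x.1) z)
      - (3/2) * (W z * h (cl (cp μ Z) (fun x => x.1.1) (fun x => Z x.1) z))
      - (1/2) * (W z * h (cl (cp μ Z) (fun x => x.2.2) (fun x => Z x.1) z))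
      + W z * Real.log A.card := by intro z; ring
    simp_rw [this]
    rw [Finset.sum_add_distrib, Finset.sum_sub_distrib, Finset.sum_sub_distrib, ← Finset.mul_sum,
      ← Finset.mul_sum, ← Finset.sum_mul, hWP.s1, a1, a2, a3]
    linarith
  obtain ⟨z, hz, hle⟩ := exists_le_of_avg hWP avg
  rw [← conv_cl hci hz] at hle
  have hp0 := hQ.cl (fun x => x.1.1) (fun x => Z x.1) hz
  have hq0 := hQ.cl (fun x => x.2.2) (fun x => Z x.1) hz
  have supA : ∀ x, cl (cp μ Z) (fun x => x.1.1) (fun x => Z x.1) z x ≠ 0 → x ∈ A := by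
    intro x hx
    obtain ⟨ω, w1, rfl, _⟩ := cl_supp hx
    have : μ ω.1 ≠ 0 := by
      intro h0
      have := law_ge hQ.nn (fun x => x.1) ω
      rw [cp_fst hμ.nn Z (fun x => x), law_id, h0] at this
      exact w1 (le_antisymm this (hQ.nn ω))
    exact (hE _ (sup _ this)).1
  set p0 := cl (cp μ Z) (fun x => x.1.1) (fun x => Z x.1) z with hp0d
  set q0 := cl (cp μ Z) (fun x => x.2.2) (fun x => Z x.1) z with hq0d
  have hA0 := h_le_log hp0 A supA
  obtain ⟨V, a, p, hp, hpV, hfin⟩ := pfr_ent h2 hp0 hq0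
  have g1 := h_conv_ge hp0 hp
  have g2 := h_conv_ge' hp0 hp
  have hpcard : h p = Real.log (Nat.card V) := by
    have hc : (Finset.univ.filter fun x => x - a ∈ V).card = Nat.card V := by
      rw [Nat.card_eq_fintype_card, Fintype.card_subtype]
      refine Finset.card_bij (fun x _ => x - a) ?_ ?_ ?_
      · intro x hx; simpa using hx
      · intro x _ y _ hxy; simpa using hxy
      · intro y hy; exact ⟨y + a, by simpa using hy, by simp⟩
    rw [← hc]
    refine (h_unif _ ⟨a, by simp⟩ fun x => ?_).2
    rw [hpV, hc]; simp
  have a4 := avg_h (hp0.pm hp) (fun x => x.1) (fun x => x.1 + x.2)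
  have e4 : H (pm p0 p) (fun x => (x.1, x.1 + x.2)) = h p0 + h p := by
    rw [← H_id p0, ← H_id p, ← H_pm hp0.nn hp.nn hp0.s1 hp.s1]
    refine H_congr (hp0.pm hp).nn _ _ (fun x y _ _ => ?_)
    simp only [Prod.mk.injEq]
    constructor
    · rintro ⟨h, h'⟩; rw [h] at h'; exact ⟨h, by simpa using h'⟩
    · rintro ⟨h, h'⟩; exact ⟨h, by rw [h, h']⟩
  rw [e4, H_add] at a4
  have a5 : ∑ w, law (pm p0 p) (fun x => x.1 + x.2) w *
      (- h (cl (pm p0 p) (fun x => x.1) (fun x => x.1 + x.2) w)) ≤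
      -(h p0 + h p - h (conv p0 p)) := by
    rw [← a4]; simp
  obtain ⟨w, hw, hwle⟩ := exists_le_of_avg ((hp0.pm hp).law _) a5
  have hcl := (hp0.pm hp).cl (fun x => x.1) (fun x => x.1 + x.2) hw
  have supw : ∀ x, cl (pm p0 p) (fun x => x.1) (fun x => x.1 + x.2) w x ≠ 0 →
      x ∈ A.filter fun x => x - (w - a) ∈ V := by
    intro x hx
    obtain ⟨ω, w1, rfl, w3⟩ := cl_supp hx
    have w1' : p0 ω.1 * p ω.2 ≠ 0 := w1
    rw [Finset.mem_filter]
    refine ⟨supA _ (left_ne_zero_of_mul w1'), ?_⟩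
    have := right_ne_zero_of_mul w1'
    rw [hpV] at this
    have hV : ω.2 - a ∈ V := by
      by_contra h0; simp [h0] at this
    rw [← w3]
    have : ω.1 - (ω.1 + ω.2 - a) = -(ω.2 - a) := by abel
    rw [this]; exact V.neg_mem hV
  have fin := h_le_log hcl _ supw
  refine ⟨V, w - a, ?_, ?_, ?_⟩
  · rw [← hpcard]; linarith
  · linarith
  · obtain ⟨x, hx⟩ : ∃ x, cl (pm p0 p) (fun x => x.1) (fun x => x.1 + x.2) w x ≠ 0 := by
      by_contra! h0
      have := hcl.s1
      simp [h0] at this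
    exact ⟨x, supw x hx⟩

end
end PFRx

namespace PFRx
section

theorem affine_count {m n : ℕ} (K : ℝ) (hK : 0 < K)
    (f : (Fin m → ZMod 2) → (Fin n → ZMod 2))
    (hf : (1 : ℝ) / K ≤
            ((Finset.univ.filter (fun p : (Fin m → ZMod 2) × (Fin m → ZMod 2) =>
              f (p.1 + p.2) = f p.1 + f p.2)).card : ℝ) /
              ((Fintype.card (Fin m → ZMod 2) : ℝ)) ^ 2) :
    ∃ (g : (Fin m → ZMod 2) →ₗ[ZMod 2] (Fin n → ZMod 2)) (c : Fin n → ZMod 2),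
      (Fintype.card (Fin m → ZMod 2) : ℝ) * Real.exp (-536 * Real.log K) ≤
        ((Finset.univ.filter (fun x => f x = g x + c)).card : ℝ) := by
  classical
  set N : ℝ := (Fintype.card (Fin m → ZMod 2) : ℝ) with hNd
  have hN : 0 < N := by rw [hNd]; exact_mod_cast Fintype.card_pos
  set Q := Finset.univ.filter (fun p : (Fin m → ZMod 2) × (Fin m → ZMod 2) =>
              f (p.1 + p.2) = f p.1 + f p.2) with hQ
  have hQpos : (0:ℝ) < Q.card := by
    have h1 : 0 < 1 / K := by positivity
    by_contra h0
    have : (Q.card : ℝ) = 0 := le_antisymm (not_lt.1 h0) (by positivity)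
    rw [this, zero_div] at hf; linarith
  have hQlog : 2 * Real.log N - Real.log K ≤ Real.log Q.card := by
    have := Real.log_le_log (by positivity) hf
    rw [Real.log_div hQpos.ne' (by positivity), Real.log_div one_ne_zero hK.ne', Real.log_one,
      Real.log_pow] at this
    push_cast at this; linarith
  have ij : Function.Injective (fun x : Fin m → ZMod 2 => (x, f x)) := fun x y h => by
    simpa using congrArg Prod.fst h
  set A := Finset.univ.image (fun x : Fin m → ZMod 2 => (x, f x)) with hA
  have hAc : (A.card : ℝ) = N := by
    rw [hA, Finset.card_image_of_injective _ ij, Finset.card_univ]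
  have ij2 : Function.Injective (fun x : (Fin m → ZMod 2) × (Fin m → ZMod 2) =>
      ((x.1, f x.1), (x.2, f x.2))) := fun x y h => by
    simp only [Prod.mk.injEq] at h
    exact Prod.ext h.1.1 h.2.1
  set E := Q.image (fun x : (Fin m → ZMod 2) × (Fin m → ZMod 2) =>
      ((x.1, f x.1), (x.2, f x.2))) with hE
  have hEc : E.card = Q.card := by
    rw [hE, Finset.card_image_of_injective _ ij2]
  have hQne : Q.Nonempty := by
    rw [← Finset.card_pos]; exact_mod_cast hQpos
  have h2 : ∀ x : (Fin m → ZMod 2) × (Fin n → ZMod 2), x + x = 0 := by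
    intro x
    have : ∀ y : ZMod 2, y + y = 0 := by decide
    ext i <;> simp [this]
  obtain ⟨V, b, hV, hA', hne⟩ := comb h2 A E (hQne.image _) (by
    intro x hx
    rw [hE, Finset.mem_image] at hx
    obtain ⟨y, hy, rfl⟩ := hx
    have hy2 : f (y.1 + y.2) = f y.1 + f y.2 := by
      rw [hQ, Finset.mem_filter] at hy; exact hy.2
    refine ⟨Finset.mem_image_of_mem _ (Finset.mem_univ _),
      Finset.mem_image_of_mem _ (Finset.mem_univ _), ?_⟩
    refine Finset.mem_image.2 ⟨y.1 + y.2, Finset.mem_univ _, ?_⟩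
    simp [hy2]) (Real.log K) (by rw [hAc, hEc]; exact hQlog)
  rw [hAc] at hV hA'
  set A' := A.filter fun x => x - b ∈ V with hA'd
  let W : Submodule (ZMod 2) ((Fin m → ZMod 2) × (Fin n → ZMod 2)) := AddSubgroup.toZModSubmodule 2 V
  have hW : ∀ x, x ∈ W ↔ x ∈ V := fun x => Iff.rfl
  let V1 := W.map (LinearMap.fst (ZMod 2) (Fin m → ZMod 2) (Fin n → ZMod 2))
  let V0 := W.comap (LinearMap.inr (ZMod 2) (Fin m → ZMod 2) (Fin n → ZMod 2))
  have hV0 : ∀ y, y ∈ V0 ↔ (0, y) ∈ V := fun y => Iff.rfl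
  let π : W →ₗ[ZMod 2] V1 :=
    (LinearMap.fst (ZMod 2) (Fin m → ZMod 2) (Fin n → ZMod 2)).submoduleMap W
  have hπ : LinearMap.range π = ⊤ :=
    LinearMap.range_eq_top.2 (LinearMap.submoduleMap_surjective _ _)
  obtain ⟨s, hs⟩ := π.exists_rightInverse_of_surjective hπ
  obtain ⟨g, hg⟩ := LinearMap.exists_extend
    ((LinearMap.snd (ZMod 2) (Fin m → ZMod 2) (Fin n → ZMod 2)) ∘ₗ W.subtype ∘ₗ s)
  have key : ∀ x, x ∈ V1 → (x, g x) ∈ V := by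
    intro x hx
    have e1 : g x = (s ⟨x, hx⟩ : (Fin m → ZMod 2) × (Fin n → ZMod 2)).2 :=
      LinearMap.congr_fun hg ⟨x, hx⟩
    have e2 : (s ⟨x, hx⟩ : (Fin m → ZMod 2) × (Fin n → ZMod 2)).1 = x :=
      congrArg Subtype.val (LinearMap.congr_fun hs ⟨x, hx⟩)
    have := (s ⟨x, hx⟩).2
    rw [hW] at this
    rw [e1]
    nth_rewrite 1 [← e2]
    exact this
  have key1 : ∀ v, v ∈ V → v.1 ∈ V1 := fun v hv => ⟨v, hv, rfl⟩
  have key0 : ∀ v, v ∈ V → v.2 - g v.1 ∈ V0 := by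
    intro v hv
    rw [hV0]
    have := V.sub_mem hv (key _ (key1 v hv))
    convert this using 1
    ext i <;> simp
  have card1 : Nat.card V1 * Nat.card V0 ≤ Nat.card V := by
    rw [← Nat.card_prod]
    refine Nat.card_le_card_of_injective
      (fun x : V1 × V0 => (⟨((x.1 : Fin m → ZMod 2), g x.1 + x.2), ?_⟩ : V)) ?_
    · have := V.add_mem (key _ x.1.2) ((hV0 _).1 x.2.2)
      convert this using 1
      ext i <;> simp
    · intro x y hxy
      simp only [Subtype.mk.injEq, Prod.mk.injEq] at hxy
      obtain ⟨h1, h3⟩ := hxy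
      rw [h1] at h3
      exact Prod.ext (Subtype.ext h1) (Subtype.ext (by simpa using h3))
  have memA : ∀ a ∈ A', a.2 = f a.1 ∧ a - b ∈ V := by
    intro a ha
    rw [hA'd, Finset.mem_filter] at ha
    refine ⟨?_, ha.2⟩
    obtain ⟨x, _, rfl⟩ := Finset.mem_image.1 ha.1
    rfl
  have card2 : A'.card ≤ Nat.card V1 := by
    rw [← Nat.card_eq_finsetCard]
    refine Nat.card_le_card_of_injective
      (fun x : A' => (⟨(x : (Fin m → ZMod 2) × (Fin n → ZMod 2)).1 - b.1, ?_⟩ : V1)) ?_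
    · exact key1 _ (memA _ x.2).2
    · intro x y hxy
      simp only [Subtype.mk.injEq, sub_left_inj] at hxy
      refine Subtype.ext (Prod.ext hxy ?_)
      rw [(memA _ x.2).1, (memA _ y.2).1, hxy]
  let T : Finset (Fin n → ZMod 2) := Finset.univ.filter fun y => y ∈ V0
  have hT : T.card = Nat.card V0 := by
    rw [Nat.card_eq_fintype_card, Fintype.card_subtype]
  have hTpos : 0 < T.card := Finset.card_pos.2 ⟨0, by simp [T]⟩
  let φ : (Fin m → ZMod 2) × (Fin n → ZMod 2) → (Fin n → ZMod 2) :=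
    fun a => (a - b).2 - g (a - b).1
  obtain ⟨v, hvT, hv⟩ : ∃ v ∈ T, A'.card ≤ T.card * (A'.filter fun a => φ a = v).card := by
    by_contra! hcon
    have e := Finset.card_eq_sum_card_fiberwise (s := A') (t := T) (f := φ)
      (fun a ha => Finset.mem_filter.2 ⟨Finset.mem_univ _, key0 _ (memA a ha).2⟩)
    have : ∑ v ∈ T, T.card * (A'.filter fun a => φ a = v).card < ∑ v ∈ T, A'.card :=
      Finset.sum_lt_sum_of_nonempty (Finset.card_pos.1 hTpos) hcon
    rw [← Finset.mul_sum, ← e, Finset.sum_const, smul_eq_mul] at this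
    exact lt_irrefl _ this
  refine ⟨g, b.2 - g b.1 + v, ?_⟩
  have card3 : (A'.filter fun a => φ a = v).card ≤
      (Finset.univ.filter (fun x => f x = g x + (b.2 - g b.1 + v))).card := by
    refine Finset.card_le_card_of_injOn (fun a => a.1) ?_ ?_
    · intro a ha
      have ha := Finset.mem_filter.1 ha
      have h3 := (memA a ha.1).1
      have h4 : a.2 - b.2 - g (a.1 - b.1) = v := ha.2
      rw [h3, map_sub] at h4
      simp only [Finset.coe_filter, Finset.mem_univ, true_and, Set.mem_ofPred_eq]
      rw [← h4]; abel
    · intro x hx y hy hxy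
      have hx := (memA x (Finset.mem_filter.1 hx).1).1
      have hy := (memA y (Finset.mem_filter.1 hy).1).1
      have hxy : x.1 = y.1 := hxy
      exact Prod.ext hxy (by rw [hx, hy, hxy])
  set S := (Finset.univ.filter (fun x => f x = g x + (b.2 - g b.1 + v))).card
  have f1 : A'.card * A'.card ≤ Nat.card V * S :=
    calc A'.card * A'.card ≤ Nat.card V1 * (T.card * S) :=
          Nat.mul_le_mul card2 (hv.trans (Nat.mul_le_mul_left _ card3))
      _ = (Nat.card V1 * Nat.card V0) * S := by rw [hT]; ring
      _ ≤ _ := Nat.mul_le_mul_right _ card1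
  have hA'pos : 0 < A'.card := Finset.card_pos.2 hne
  have hSpos : 0 < S := by
    rcases Nat.eq_zero_or_pos S with h0 | h0
    · rw [h0, mul_zero] at f1
      have := Nat.mul_pos hA'pos hA'pos
      omega
    · exact h0
  have hVpos : 0 < Nat.card V := Nat.card_pos
  have r1 : (0:ℝ) < A'.card := by exact_mod_cast hA'pos
  have r2 : (0:ℝ) < S := by exact_mod_cast hSpos
  have r3 : (0:ℝ) < Nat.card V := by exact_mod_cast hVpos
  have f2 : (A'.card : ℝ) * A'.card ≤ Nat.card V * S := by exact_mod_cast f1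
  have f3 := Real.log_le_log (by positivity) f2
  rw [Real.log_mul r1.ne' r1.ne', Real.log_mul r3.ne' r2.ne'] at f3
  rw [← Real.exp_log hN, ← Real.exp_log r2, ← Real.exp_add, Real.exp_le_exp]
  linarith

theorem half_count {m : ℕ} (x : Fin m → ZMod 2) (hx : x ≠ 0) :
    Fintype.card (Fin m → ZMod 2) ≤
      2 * (Finset.univ.filter fun u : Fin m → ZMod 2 => u ⬝ᵥ x = 1).card := by
  classical
  obtain ⟨i, hi⟩ := Function.ne_iff.1 hx
  have two : ∀ y : ZMod 2, y ≠ 0 → y = 1 := by decide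
  have two' : ∀ y : ZMod 2, y ≠ 1 → y + 1 = 1 := by decide
  have hi1 : x i = 1 := two _ hi
  have h1 := Finset.card_filter_add_card_filter_not (s := (Finset.univ : Finset (Fin m → ZMod 2)))
    (fun u => u ⬝ᵥ x = 1)
  have h2 : (Finset.univ.filter fun u : Fin m → ZMod 2 => ¬ u ⬝ᵥ x = 1).card ≤
      (Finset.univ.filter fun u : Fin m → ZMod 2 => u ⬝ᵥ x = 1).card := by
    refine Finset.card_le_card_of_injOn (fun u => u + Pi.single i 1) ?_ ?_
    · intro u hu
      simp only [Finset.coe_filter, Finset.mem_univ, true_and, Set.mem_ofPred_eq] at hu ⊢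
      rw [add_dotProduct, single_dotProduct, hi1, one_mul]
      exact two' _ hu
    · intro u _ w _ h
      simpa using h
  rw [Finset.card_univ] at h1
  omega

def lf {m : ℕ} (u : Fin m → ZMod 2) : (Fin m → ZMod 2) →ₗ[ZMod 2] ZMod 2 where
  toFun x := u ⬝ᵥ x
  map_add' := dotProduct_add u
  map_smul' r x := by simp [dotProduct_smul]

theorem lin_count {m n : ℕ} (f : (Fin m → ZMod 2) → (Fin n → ZMod 2)) (h0 : m = 0 → f 0 = 0)
    (g : (Fin m → ZMod 2) →ₗ[ZMod 2] (Fin n → ZMod 2)) (c : Fin n → ZMod 2) :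
    ∃ g' : (Fin m → ZMod 2) →ₗ[ZMod 2] (Fin n → ZMod 2),
      (Finset.univ.filter (fun x => f x = g x + c)).card ≤
        4 * (Finset.univ.filter (fun x => f x = g' x)).card := by
  classical
  set S := Finset.univ.filter (fun x => f x = g x + c) with hS
  have hc : S.card ≤ (S.erase 0).card + 1 := by
    have := Finset.pred_card_le_card_erase (s := S) (a := 0)
    omega
  rcases (S.erase 0).eq_empty_or_nonempty with he | hne
  · rw [he, Finset.card_empty] at hc
    suffices ∃ g' : (Fin m → ZMod 2) →ₗ[ZMod 2] (Fin n → ZMod 2), ∃ x, f x = g' x by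
      obtain ⟨g', x, hx⟩ := this
      refine ⟨g', ?_⟩
      have : 0 < (Finset.univ.filter (fun x => f x = g' x)).card :=
        Finset.card_pos.2 ⟨x, by simp [hx]⟩
      omega
    by_cases hm : m = 0
    · exact ⟨0, 0, by simp [h0 hm]⟩
    · let i : Fin m := ⟨0, Nat.pos_of_ne_zero hm⟩
      refine ⟨(lf (Pi.single i 1)).smulRight (f (Pi.single i 1)), Pi.single i 1, ?_⟩
      simp [lf]
  · have dc : ∑ u : Fin m → ZMod 2, 2 * ((S.erase 0).filter fun x => u ⬝ᵥ x = 1).card =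
        ∑ x ∈ S.erase 0, 2 * (Finset.univ.filter fun u : Fin m → ZMod 2 => u ⬝ᵥ x = 1).card := by
      simp only [Finset.card_filter, ← Finset.mul_sum]
      rw [Finset.sum_comm]
    have lb : ∑ u : Fin m → ZMod 2, (S.erase 0).card ≤
        ∑ u : Fin m → ZMod 2, 2 * ((S.erase 0).filter fun x => u ⬝ᵥ x = 1).card := by
      rw [dc, Finset.sum_const, smul_eq_mul, Finset.card_univ, mul_comm, ← smul_eq_mul,
        ← Finset.sum_const]
      exact Finset.sum_le_sum fun x hx => half_count x (Finset.ne_of_mem_erase hx)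
    obtain ⟨u, _, hu⟩ := Finset.exists_le_of_sum_le Finset.univ_nonempty lb
    refine ⟨g + (lf u).smulRight c, ?_⟩
    have : ((S.erase 0).filter fun x => u ⬝ᵥ x = 1).card ≤
        (Finset.univ.filter (fun x => f x = (g + (lf u).smulRight c) x)).card := by
      refine Finset.card_le_card fun x hx => ?_
      simp only [Finset.mem_filter, hS, Finset.mem_erase, Finset.mem_univ, true_and] at hx ⊢
      have e : lf u x = 1 := hx.2
      simp [e, hx.1.2]
    have := hne.card_pos
    omega

end
end PFRx

theorem approximate_hom_correlation :
    ∃ C₄ c : ℝ, 0 < C₄ ∧ 0 < c ∧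
      ∀ (m n : ℕ) (K : ℝ), 0 < K →
        ∀ f : (Fin m → ZMod 2) → (Fin n → ZMod 2),
          (1 : ℝ) / K ≤
            ((Finset.univ.filter (fun p : (Fin m → ZMod 2) × (Fin m → ZMod 2) =>
              f (p.1 + p.2) = f p.1 + f p.2)).card : ℝ) /
              ((Fintype.card (Fin m → ZMod 2) : ℝ)) ^ 2 →
          ∃ g : (Fin m → ZMod 2) →ₗ[ZMod 2] (Fin n → ZMod 2),
            c * K ^ (-C₄) ≤
              ((Finset.univ.filter (fun x : Fin m → ZMod 2 => f x = g x)).card : ℝ) /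
                (Fintype.card (Fin m → ZMod 2) : ℝ) := by
  refine ⟨536, 1/4, by norm_num, by norm_num, ?_⟩
  intro m n K hK f hf
  obtain ⟨g, c, hgc⟩ := PFRx.affine_count K hK f hf
  have h0 : m = 0 → f 0 = 0 := by
    rintro rfl
    by_contra hne
    have : (Finset.univ.filter (fun p : (Fin 0 → ZMod 2) × (Fin 0 → ZMod 2) =>
              f (p.1 + p.2) = f p.1 + f p.2)) = ∅ := by
      refine Finset.filter_eq_empty_iff.2 fun p _ hp => hne ?_
      rw [Subsingleton.elim (p.1 + p.2) 0, Subsingleton.elim p.1 0, Subsingleton.elim p.2 0] at hp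
      simpa using hp
    rw [this] at hf
    have : 0 < 1 / K := by positivity
    simp at hf
    linarith
  obtain ⟨g', hg'⟩ := PFRx.lin_count f h0 g c
  refine ⟨g', ?_⟩
  have hN : (0:ℝ) < (Fintype.card (Fin m → ZMod 2) : ℝ) := by exact_mod_cast Fintype.card_pos
  rw [le_div_iff₀ hN, Real.rpow_def_of_pos hK]
  have h3 : ((Finset.univ.filter (fun x => f x = g x + c)).card : ℝ) ≤
        4 * ((Finset.univ.filter (fun x => f x = g' x)).card : ℝ) := by exact_mod_cast hg'
  rw [show Real.log K * -536 = -536 * Real.log K by ring]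
  linarith
end

section
/- Let G = F_2^n, fix finitely supported G-valued random variables X_1^0, X_2^0, set η = 1/9, and define τ[X_1; X_2] := d[X_1; X_2] + η·d[X_1^0; X_1] + η·d[X_2^0; X_2] for any pair of finitely supported G-valued random variables X_1, X_2. If X_1, X_2 are finitely supported G-valued random variables with d[X_1; X_2] > 0, then there exist finitely supported G-valued random variables X_1', X_2' such that τ[X_1'; X_2'] < τ[X_1; X_2]. -/
open scoped Classical BigOperators Pointwise
open Finset

noncomputable section

/-- The probability that the random variable `X` equals `s`, under the pmf `μ`. -/
def pmass {Ω S : Type*} [Fintype Ω] (μ : Ω → ℝ) (X : Ω → S) (s : S) : ℝ :=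
  ∑ ω, if X ω = s then μ ω else 0

/-- `μ` is a probability mass function on the finite type `Ω`. -/
def IsProb {Ω : Type*} [Fintype Ω] (μ : Ω → ℝ) : Prop :=
  (∀ ω, 0 ≤ μ ω) ∧ ∑ ω, μ ω = 1

/-- Shannon entropy `H[X]` of a random variable `X : Ω → S` under `μ`. -/
def ent {Ω S : Type*} [Fintype Ω] (μ : Ω → ℝ) (X : Ω → S) : ℝ :=
  ∑ s ∈ Finset.univ.image X, Real.negMulLog (pmass μ X s)

/-- Mutual information `I[X : Y]`. -/
def mutualInfo {Ω S T : Type*} [Fintype Ω] (μ : Ω → ℝ) (X : Ω → S) (Y : Ω → T) : ℝ :=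
  ent μ X + ent μ Y - ent μ (fun ω => (X ω, Y ω))

/-- The conditional measure, conditioning on the event `Y = y`. -/
def condMeas {Ω T : Type*} [Fintype Ω] (μ : Ω → ℝ) (Y : Ω → T) (y : T) : Ω → ℝ :=
  fun ω => if Y ω = y then μ ω / pmass μ Y y else 0

/-- Conditional mutual information `I[X : Y | Z]`. -/
def condMutualInfo {Ω S T U : Type*} [Fintype Ω] (μ : Ω → ℝ)
    (X : Ω → S) (Y : Ω → T) (Z : Ω → U) : ℝ :=
  ∑ z ∈ Finset.univ.image Z, pmass μ Z z * mutualInfo (condMeas μ Z z) X Y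

/-- Entropic Ruzsa distance `d[X ; Y]`, defined via independent copies on a product space. -/
def rdist {Ω₁ Ω₂ G : Type*} [Fintype Ω₁] [Fintype Ω₂] [AddCommGroup G]
    (μ₁ : Ω₁ → ℝ) (X : Ω₁ → G) (μ₂ : Ω₂ → ℝ) (Y : Ω₂ → G) : ℝ :=
  ent (fun p : Ω₁ × Ω₂ => μ₁ p.1 * μ₂ p.2) (fun p => X p.1 - Y p.2)
    - ent μ₁ X / 2 - ent μ₂ Y / 2

/-- Conditional Ruzsa distance `d[X | Z ; Y | W]`. -/
def condRdist {Ω₁ Ω₂ G T U : Type*} [Fintype Ω₁] [Fintype Ω₂] [AddCommGroup G]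
    (μ₁ : Ω₁ → ℝ) (X : Ω₁ → G) (Z : Ω₁ → T)
    (μ₂ : Ω₂ → ℝ) (Y : Ω₂ → G) (W : Ω₂ → U) : ℝ :=
  ∑ z ∈ Finset.univ.image Z, ∑ w ∈ Finset.univ.image W,
    pmass μ₁ Z z * pmass μ₂ W w * rdist (condMeas μ₁ Z z) X (condMeas μ₂ W w) Y

/-- Conditional Ruzsa distance `d[X ; Y | W]`, conditioning only on the right variable. -/
def condRdistRight {Ω₁ Ω₂ G U : Type*} [Fintype Ω₁] [Fintype Ω₂] [AddCommGroup G]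
    (μ₁ : Ω₁ → ℝ) (X : Ω₁ → G)
    (μ₂ : Ω₂ → ℝ) (Y : Ω₂ → G) (W : Ω₂ → U) : ℝ :=
  ∑ w ∈ Finset.univ.image W, pmass μ₂ W w * rdist μ₁ X (condMeas μ₂ W w) Y

/-- The uniform probability mass function on a subset `H` of a finite type. -/
def unifOn {G : Type*} [Fintype G] (H : Set G) : G → ℝ :=
  fun g => if g ∈ H then ((Nat.card H : ℝ))⁻¹ else 0

/-- `X` (under `μ₁`) and `Y` (under `μ₂`) are identically distributed. -/
def IdentDist {Ω₁ Ω₂ S : Type*} [Fintype Ω₁] [Fintype Ω₂]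
    (μ₁ : Ω₁ → ℝ) (X : Ω₁ → S) (μ₂ : Ω₂ → ℝ) (Y : Ω₂ → S) : Prop :=
  ∀ s, pmass μ₁ X s = pmass μ₂ Y s

/-- Two random variables are independent. -/
def IndepPair {Ω S T : Type*} [Fintype Ω] (μ : Ω → ℝ) (X : Ω → S) (Y : Ω → T) : Prop :=
  ∀ s t, pmass μ (fun ω => (X ω, Y ω)) (s, t) = pmass μ X s * pmass μ Y t

/-- Three random variables are jointly independent. -/
def IndepTriple {Ω S T U : Type*} [Fintype Ω] (μ : Ω → ℝ)
    (X : Ω → S) (Y : Ω → T) (Z : Ω → U) : Prop :=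
  ∀ s t u, pmass μ (fun ω => (X ω, Y ω, Z ω)) (s, t, u)
    = pmass μ X s * pmass μ Y t * pmass μ Z u

/-- Four random variables are jointly independent. -/
def IndepFour {Ω S T U V : Type*} [Fintype Ω] (μ : Ω → ℝ)
    (X : Ω → S) (Y : Ω → T) (Z : Ω → U) (W : Ω → V) : Prop :=
  ∀ s t u v, pmass μ (fun ω => (X ω, Y ω, Z ω, W ω)) (s, t, u, v)
    = pmass μ X s * pmass μ Y t * pmass μ Z u * pmass μ W v


lemma pmass_nonneg' {Ω S : Type*} [Fintype Ω] {μ : Ω → ℝ} (h : ∀ ω, 0 ≤ μ ω) (X : Ω → S) (s : S) :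
    0 ≤ pmass μ X s := by
  unfold pmass
  refine Finset.sum_nonneg fun ω _ => ?_
  split_ifs
  · exact h ω
  · exact le_rfl

lemma le_pmass {Ω S : Type*} [Fintype Ω] {μ : Ω → ℝ} (h : ∀ ω, 0 ≤ μ ω) (X : Ω → S) (ω : Ω) :
    μ ω ≤ pmass μ X (X ω) := by
  unfold pmass
  have := Finset.single_le_sum (f := fun ω' => if X ω' = X ω then μ ω' else 0) (s := Finset.univ)
    (fun i _ => by split_ifs; exacts [h i, le_rfl]) (Finset.mem_univ ω)
  simpa using this

lemma ent_eq_sum {Ω S : Type*} [Fintype Ω] (μ : Ω → ℝ) (X : Ω → S) :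
    ent μ X = - ∑ ω, μ ω * Real.log (pmass μ X (X ω)) := by
  unfold ent
  rw [← Finset.sum_fiberwise_of_maps_to (s := Finset.univ) (t := Finset.univ.image X) (g := X)
    (fun i _ => Finset.mem_image_of_mem X (Finset.mem_univ i)), ← Finset.sum_neg_distrib]
  refine Finset.sum_congr rfl fun s _ => ?_
  have h1 : ∑ i with X i = s, μ i * Real.log (pmass μ X (X i))
      = ∑ i with X i = s, μ i * Real.log (pmass μ X s) := by
    refine Finset.sum_congr rfl fun i hi => ?_
    rw [(Finset.mem_filter.1 hi).2]
  rw [h1, ← Finset.sum_mul, Finset.sum_filter]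
  unfold Real.negMulLog
  rw [neg_mul]
  rfl

lemma ent_eq_univ {Ω S : Type*} [Fintype Ω] [Fintype S] (μ : Ω → ℝ) (X : Ω → S) :
    ent μ X = ∑ s, Real.negMulLog (pmass μ X s) := by
  unfold ent
  refine Finset.sum_subset (Finset.subset_univ _) fun s _ hs => ?_
  have : pmass μ X s = 0 := by
    unfold pmass
    refine Finset.sum_eq_zero fun ω _ => ?_
    rw [if_neg]
    rintro rfl
    exact hs (Finset.mem_image_of_mem X (Finset.mem_univ ω))
  rw [this, Real.negMulLog_zero]

lemma ent_dist {Ω Ω' S : Type*} [Fintype Ω] [Fintype Ω'] [Fintype S] {μ : Ω → ℝ} {X : Ω → S}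
    {ν : Ω' → ℝ} {Y : Ω' → S} (h : ∀ s, pmass μ X s = pmass ν Y s) : ent μ X = ent ν Y := by
  simp only [ent_eq_univ, h]

lemma pmass_congr {Ω S T : Type*} [Fintype Ω] (μ : Ω → ℝ) {X : Ω → S} {Y : Ω → T} {s : S} {t : T}
    (h : ∀ ω, X ω = s ↔ Y ω = t) : pmass μ X s = pmass μ Y t := by
  unfold pmass
  refine Finset.sum_congr rfl fun ω _ => ?_
  simp only [h ω]

lemma ent_congr {Ω S T : Type*} [Fintype Ω] (μ : Ω → ℝ) {X : Ω → S} {Y : Ω → T}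
    (h : ∀ ω ω', X ω = X ω' ↔ Y ω = Y ω') : ent μ X = ent μ Y := by
  rw [ent_eq_sum, ent_eq_sum]
  congr 1
  refine Finset.sum_congr rfl fun ω _ => ?_
  rw [pmass_congr μ (fun ω' => h ω' ω)]

lemma sum_pmass_mul {Ω S : Type*} [Fintype Ω] [Fintype S] (μ : Ω → ℝ) (X : Ω → S) (g : S → ℝ) :
    ∑ s, pmass μ X s * g s = ∑ ω, μ ω * g (X ω) := by
  unfold pmass
  simp only [Finset.sum_mul, ite_mul, zero_mul]
  rw [Finset.sum_comm]
  refine Finset.sum_congr rfl fun ω _ => ?_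
  simp

lemma sum_pmass {Ω S : Type*} [Fintype Ω] [Fintype S] (μ : Ω → ℝ) (X : Ω → S) :
    ∑ s, pmass μ X s = ∑ ω, μ ω := by
  simpa using sum_pmass_mul μ X (fun _ => 1)

lemma pmass_comp {Ω S T : Type*} [Fintype Ω] [Fintype S] (μ : Ω → ℝ) (X : Ω → S) (f : S → T)
    (t : T) : pmass μ (fun ω => f (X ω)) t = ∑ s, pmass μ X s * (if f s = t then 1 else 0) := by
  rw [sum_pmass_mul]
  unfold pmass
  simp

lemma pmass_comp_congr {Ω Ω' S T : Type*} [Fintype Ω] [Fintype Ω'] [Fintype S] {μ : Ω → ℝ}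
    {X : Ω → S} {ν : Ω' → ℝ} {Y : Ω' → S} (h : ∀ s, pmass μ X s = pmass ν Y s) (f : S → T) (t : T) :
    pmass μ (fun ω => f (X ω)) t = pmass ν (fun ω => f (Y ω)) t := by
  rw [pmass_comp, pmass_comp]; simp only [h]

lemma pmass_fst {Ω S T : Type*} [Fintype Ω] [Fintype T] (μ : Ω → ℝ) (X : Ω → S) (Y : Ω → T)
    (s : S) : ∑ t, pmass μ (fun ω => (X ω, Y ω)) (s, t) = pmass μ X s := by
  unfold pmass
  rw [Finset.sum_comm]
  refine Finset.sum_congr rfl fun ω _ => ?_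
  by_cases h : X ω = s <;> simp [h]

lemma pmass_snd {Ω S T : Type*} [Fintype Ω] [Fintype S] (μ : Ω → ℝ) (X : Ω → S) (Y : Ω → T)
    (t : T) : ∑ s, pmass μ (fun ω => (X ω, Y ω)) (s, t) = pmass μ Y t := by
  unfold pmass
  rw [Finset.sum_comm]
  refine Finset.sum_congr rfl fun ω _ => ?_
  by_cases h : Y ω = t <;> simp [h]

lemma submod {Ω S T U : Type*} [Fintype Ω] [Fintype S] [Fintype T] [Fintype U] {μ : Ω → ℝ}
    (hμ : ∀ ω, 0 ≤ μ ω) (X : Ω → S) (Y : Ω → T) (Z : Ω → U) :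
    ent μ (fun ω => (X ω, Y ω, Z ω)) + ent μ Z
      ≤ ent μ (fun ω => (X ω, Z ω)) + ent μ (fun ω => (Y ω, Z ω)) := by
  set q := pmass μ (fun ω => (X ω, Y ω, Z ω)) with hq
  set qc := pmass μ Z with hqc
  set qa := pmass μ (fun ω => (X ω, Z ω)) with hqa
  set qb := pmass μ (fun ω => (Y ω, Z ω)) with hqb
  have key : ∀ ω, μ ω * (1 - qa (X ω, Z ω) * qb (Y ω, Z ω) / (qc (Z ω)) / q (X ω, Y ω, Z ω))
      ≤ μ ω * Real.log (q (X ω, Y ω, Z ω)) + μ ω * Real.log (qc (Z ω))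
        - μ ω * Real.log (qa (X ω, Z ω)) - μ ω * Real.log (qb (Y ω, Z ω)) := by
    intro ω
    rcases (hμ ω).eq_or_lt with h0 | h0
    · simp [← h0]
    have h1 : 0 < q (X ω, Y ω, Z ω) := h0.trans_le (le_pmass hμ (fun ω => (X ω, Y ω, Z ω)) ω)
    have h2 : 0 < qc (Z ω) := h0.trans_le (le_pmass hμ Z ω)
    have h3 : 0 < qa (X ω, Z ω) := h0.trans_le (le_pmass hμ (fun ω => (X ω, Z ω)) ω)
    have h4 : 0 < qb (Y ω, Z ω) := h0.trans_le (le_pmass hμ (fun ω => (Y ω, Z ω)) ω)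
    have := Real.log_le_sub_one_of_pos (x := qa (X ω, Z ω) * qb (Y ω, Z ω) / (qc (Z ω)) / q (X ω, Y ω, Z ω))
      (by positivity)
    rw [Real.log_div (by positivity) (by positivity), Real.log_div (by positivity) (by positivity),
      Real.log_mul (by positivity) (by positivity)] at this
    nlinarith [mul_le_mul_of_nonneg_left this h0.le]
  have hsum := Finset.sum_le_sum (s := Finset.univ) fun ω _ => key ω
  have hl : 0 ≤ ∑ ω, μ ω * (1 - qa (X ω, Z ω) * qb (Y ω, Z ω) / (qc (Z ω)) / q (X ω, Y ω, Z ω)) := by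
    simp only [mul_sub, mul_one, Finset.sum_sub_distrib]
    have e1 := sum_pmass_mul μ (fun ω => (X ω, Y ω, Z ω))
      (fun s => qa (s.1, s.2.2) * qb (s.2.1, s.2.2) / qc s.2.2 / q s)
    have e2 : ∑ s : S × T × U, qa (s.1, s.2.2) * qb (s.2.1, s.2.2) / qc s.2.2 = ∑ ω, μ ω := by
      rw [← sum_pmass μ Z, Fintype.sum_prod_type]
      simp only [Fintype.sum_prod_type]
      have : ∀ x : S, ∑ y : T, ∑ z : U, qa (x, z) * qb (y, z) / qc z
          = ∑ z : U, qa (x, z) * (qc z / qc z) := by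
        intro x
        rw [Finset.sum_comm]
        refine Finset.sum_congr rfl fun z _ => ?_
        rw [← Finset.sum_div, ← Finset.mul_sum, hqb, pmass_snd μ Y Z z, mul_div_assoc]
      simp only [this]
      rw [Finset.sum_comm]
      refine Finset.sum_congr rfl fun z _ => ?_
      rw [← Finset.sum_mul, hqa, pmass_snd μ X Z z, ← hqc]
      by_cases h : qc z = 0
      · simp [h]
      · field_simp
    dsimp only at e1
    rw [sub_nonneg, ← e1, ← e2]
    refine Finset.sum_le_sum fun s _ => ?_
    have n1 : 0 ≤ qa (s.1, s.2.2) * qb (s.2.1, s.2.2) / qc s.2.2 :=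
      div_nonneg (mul_nonneg (pmass_nonneg' hμ _ _) (pmass_nonneg' hμ _ _)) (pmass_nonneg' hμ _ _)
    by_cases h : q s = 0
    · rw [← hq, h]; simpa using n1
    · rw [← hq, mul_div_cancel₀ _ h]
  simp only [Finset.sum_add_distrib, Finset.sum_sub_distrib] at hsum
  rw [ent_eq_sum, ent_eq_sum μ Z, ent_eq_sum μ (fun ω => (X ω, Z ω)), ent_eq_sum μ (fun ω => (Y ω, Z ω))]
  linarith

/-- conditional independence -/
def CI {Ω S T U : Type*} [Fintype Ω] (μ : Ω → ℝ) (X : Ω → S) (Y : Ω → T) (Z : Ω → U) : Prop :=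
  ∀ a b c, pmass μ (fun ω => (X ω, Y ω, Z ω)) (a, b, c) * pmass μ Z c
    = pmass μ (fun ω => (X ω, Z ω)) (a, c) * pmass μ (fun ω => (Y ω, Z ω)) (b, c)

lemma CI.ent_eq {Ω S T U : Type*} [Fintype Ω] {μ : Ω → ℝ} (hμ : ∀ ω, 0 ≤ μ ω) {X : Ω → S}
    {Y : Ω → T} {Z : Ω → U} (h : CI μ X Y Z) :
    ent μ (fun ω => (X ω, Y ω, Z ω)) + ent μ Z
      = ent μ (fun ω => (X ω, Z ω)) + ent μ (fun ω => (Y ω, Z ω)) := by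
  simp only [ent_eq_sum, ← neg_add, ← Finset.sum_add_distrib]
  congr 1
  refine Finset.sum_congr rfl fun ω _ => ?_
  rcases (hμ ω).eq_or_lt with h0 | h0
  · simp [← h0]
  have h1 := h0.trans_le (le_pmass hμ (fun ω => (X ω, Y ω, Z ω)) ω)
  have h2 := h0.trans_le (le_pmass hμ Z ω)
  have h3 := h0.trans_le (le_pmass hμ (fun ω => (X ω, Z ω)) ω)
  have h4 := h0.trans_le (le_pmass hμ (fun ω => (Y ω, Z ω)) ω)
  rw [← mul_add, ← mul_add, ← Real.log_mul h1.ne' h2.ne', ← Real.log_mul h3.ne' h4.ne',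
    h (X ω) (Y ω) (Z ω)]

lemma ind_ent {Ω S T : Type*} [Fintype Ω] {μ : Ω → ℝ} (hμ : ∀ ω, 0 ≤ μ ω) {X : Ω → S}
    {Y : Ω → T} (h : IndepPair μ X Y) :
    ent μ (fun ω => (X ω, Y ω)) = ent μ X + ent μ Y := by
  simp only [ent_eq_sum, ← neg_add, ← Finset.sum_add_distrib]
  congr 1
  refine Finset.sum_congr rfl fun ω _ => ?_
  rcases (hμ ω).eq_or_lt with h0 | h0
  · simp [← h0]
  have h3 := h0.trans_le (le_pmass hμ X ω)
  have h4 := h0.trans_le (le_pmass hμ Y ω)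
  rw [← mul_add, ← Real.log_mul h3.ne' h4.ne', h (X ω) (Y ω)]

lemma ind_comp {Ω S T S' T' : Type*} [Fintype Ω] [Fintype S] [Fintype T] {μ : Ω → ℝ} {X : Ω → S}
    {Y : Ω → T} (h : IndepPair μ X Y) (f : S → S') (g : T → T') :
    IndepPair μ (fun ω => f (X ω)) (fun ω => g (Y ω)) := by
  intro s t
  have := pmass_comp μ (fun ω => (X ω, Y ω)) (fun p => (f p.1, g p.2)) (s, t)
  dsimp only at this
  rw [this, pmass_comp μ X f, pmass_comp μ Y g, Fintype.sum_prod_type, Finset.sum_mul_sum]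
  refine Finset.sum_congr rfl fun a _ => Finset.sum_congr rfl fun b _ => ?_
  rw [h a b]
  by_cases h1 : f a = s <;> by_cases h2 : g b = t <;> simp [h1, h2]

lemma ind_CI {Ω S T S' T' : Type*} [Fintype Ω] [Fintype S] [Fintype T] [Fintype S'] [Fintype T']
    {μ : Ω → ℝ} {X : Ω → S} {Y : Ω → T} {Z : Ω → S'} {W : Ω → T'}
    (h : IndepPair μ (fun ω => (X ω, Z ω)) (fun ω => (Y ω, W ω))) :
    CI μ X Y (fun ω => (Z ω, W ω)) := by
  rintro a b ⟨z, w⟩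
  have h1 := h (a, z) (b, w)
  have h2 := ind_comp h Prod.snd Prod.snd z w
  have h3 := ind_comp h id Prod.snd (a, z) w
  have h4 := ind_comp h Prod.snd id z (b, w)
  dsimp only [id] at h2 h3 h4
  have e1 : pmass μ (fun ω => (X ω, Y ω, Z ω, W ω)) (a, b, z, w)
      = pmass μ (fun ω => ((X ω, Z ω), Y ω, W ω)) ((a, z), b, w) :=
    pmass_congr μ fun ω => by simp only [Prod.mk.injEq]; tauto
  have e3 : pmass μ (fun ω => (X ω, Z ω, W ω)) (a, z, w)
      = pmass μ (fun ω => ((X ω, Z ω), W ω)) ((a, z), w) :=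
    pmass_congr μ fun ω => by simp only [Prod.mk.injEq]; tauto
  have e4 : pmass μ (fun ω => (Y ω, Z ω, W ω)) (b, z, w)
      = pmass μ (fun ω => (Z ω, Y ω, W ω)) (z, b, w) :=
    pmass_congr μ fun ω => by simp only [Prod.mk.injEq]; tauto
  rw [e1, e3, e4, h1, h2, h3, h4]
  ring

/-- product measure -/
def prodM {Ω Ω' : Type*} (μ : Ω → ℝ) (ν : Ω' → ℝ) : Ω × Ω' → ℝ := fun p => μ p.1 * ν p.2

lemma prodM_prob {Ω Ω' : Type*} [Fintype Ω] [Fintype Ω'] {μ : Ω → ℝ} {ν : Ω' → ℝ}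
    (hμ : IsProb μ) (hν : IsProb ν) : IsProb (prodM μ ν) := by
  refine ⟨fun p => mul_nonneg (hμ.1 _) (hν.1 _), ?_⟩
  unfold prodM
  rw [Fintype.sum_prod_type, ← Finset.sum_mul_sum, hμ.2, hν.2, one_mul]

lemma pmass_prodM {Ω Ω' S T : Type*} [Fintype Ω] [Fintype Ω'] (μ : Ω → ℝ) (ν : Ω' → ℝ)
    (X : Ω → S) (Y : Ω' → T) (s : S) (t : T) :
    pmass (prodM μ ν) (fun p => (X p.1, Y p.2)) (s, t) = pmass μ X s * pmass ν Y t := by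
  unfold pmass prodM
  rw [Fintype.sum_prod_type, Finset.sum_mul_sum]
  refine Finset.sum_congr rfl fun a _ => Finset.sum_congr rfl fun b _ => ?_
  by_cases h1 : X a = s <;> by_cases h2 : Y b = t <;> simp [h1, h2]

lemma pmass_prodM_fst {Ω Ω' S : Type*} [Fintype Ω] [Fintype Ω'] (μ : Ω → ℝ) {ν : Ω' → ℝ}
    (hν : IsProb ν) (X : Ω → S) (s : S) :
    pmass (prodM μ ν) (fun p => X p.1) s = pmass μ X s := by
  unfold pmass prodM
  rw [Fintype.sum_prod_type]
  refine Finset.sum_congr rfl fun a _ => ?_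
  by_cases h1 : X a = s <;> simp [h1, ← Finset.mul_sum, hν.2]

lemma pmass_prodM_snd {Ω Ω' S : Type*} [Fintype Ω] [Fintype Ω'] {μ : Ω → ℝ} (ν : Ω' → ℝ)
    (hμ : IsProb μ) (X : Ω' → S) (s : S) :
    pmass (prodM μ ν) (fun p => X p.2) s = pmass ν X s := by
  unfold pmass prodM
  rw [Fintype.sum_prod_type, Finset.sum_comm]
  refine Finset.sum_congr rfl fun a _ => ?_
  by_cases h1 : X a = s <;> simp [h1, ← Finset.sum_mul, hμ.2]

lemma ind_prodM {Ω Ω' S T : Type*} [Fintype Ω] [Fintype Ω'] {μ : Ω → ℝ} {ν : Ω' → ℝ}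
    (hμ : IsProb μ) (hν : IsProb ν) (X : Ω → S) (Y : Ω' → T) :
    IndepPair (prodM μ ν) (fun p => X p.1) (fun p => Y p.2) := by
  intro s t
  rw [pmass_prodM, pmass_prodM_fst μ hν, pmass_prodM_snd ν hμ]

lemma condMeas_prob {Ω T : Type*} [Fintype Ω] {μ : Ω → ℝ} (hμ : IsProb μ) (C : Ω → T) (c : T)
    (h : pmass μ C c ≠ 0) : IsProb (condMeas μ C c) := by
  refine ⟨fun ω => ?_, ?_⟩
  · unfold condMeas; split_ifs
    · exact div_nonneg (hμ.1 _) (pmass_nonneg' hμ.1 _ _)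
    · exact le_rfl
  · unfold condMeas
    have : ∀ ω, (if C ω = c then μ ω / pmass μ C c else 0) = (if C ω = c then μ ω else 0) / pmass μ C c := by
      intro ω; split_ifs <;> simp
    simp only [this]
    rw [← Finset.sum_div]
    exact div_self h

lemma pmass_condMeas {Ω S T : Type*} [Fintype Ω] (μ : Ω → ℝ) (X : Ω → S) (C : Ω → T) (s : S) (c : T) :
    pmass (condMeas μ C c) X s = pmass μ (fun ω => (X ω, C ω)) (s, c) / pmass μ C c := by
  conv_lhs => unfold pmass condMeas
  conv_rhs => enter [1]; unfold pmass
  rw [Finset.sum_div]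
  refine Finset.sum_congr rfl fun ω _ => ?_
  by_cases h1 : X ω = s <;> by_cases h2 : C ω = c <;> simp [h1, h2]

lemma chain_rule {Ω S T : Type*} [Fintype Ω] [Fintype T] {μ : Ω → ℝ} (hμ : ∀ ω, 0 ≤ μ ω) (X : Ω → S) (C : Ω → T) :
    ∑ c, pmass μ C c * ent (condMeas μ C c) X = ent μ (fun ω => (X ω, C ω)) - ent μ C := by
  have e : ∀ c, pmass μ C c * ent (condMeas μ C c) X = - ∑ ω, if C ω = c then
      μ ω * Real.log (pmass μ (fun ω => (X ω, C ω)) (X ω, C ω)) - μ ω * Real.log (pmass μ C (C ω)) else 0 := by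
    intro c
    rw [ent_eq_sum, mul_neg, Finset.mul_sum]
    congr 1
    refine Finset.sum_congr rfl fun ω _ => ?_
    rw [pmass_condMeas]
    unfold condMeas
    split_ifs with h
    · subst h
      rcases (hμ ω).eq_or_lt with h0 | h0
      · simp [← h0]
      have h3 := h0.trans_le (le_pmass hμ C ω)
      have h4 := h0.trans_le (le_pmass hμ (fun ω => (X ω, C ω)) ω)
      rw [Real.log_div h4.ne' h3.ne']
      field_simp
    · simp
  simp only [e]
  rw [Finset.sum_neg_distrib, Finset.sum_comm, ent_eq_sum, ent_eq_sum]
  simp only [Finset.sum_ite_eq, Finset.mem_univ, if_true, Finset.sum_sub_distrib]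
  ring

/-- the group -/
abbrev VV (n : ℕ) := Fin n → ZMod 2

lemma vv_two (n : ℕ) : (2 : VV n) = 0 := by
  funext i
  exact (by decide : (2 : ZMod 2) = 0)

lemma vv_sub {n : ℕ} (x y : VV n) : x - y = x + y := by
  linear_combination (-y) * vv_two n

/-- conditional distance to a reference variable -/
def DD {n : ℕ} {Ω₀ Ω T : Type*} [Fintype Ω₀] [Fintype Ω] (μ₀ : Ω₀ → ℝ) (X₀ : Ω₀ → VV n)
    (μ : Ω → ℝ) (A : Ω → VV n) (C : Ω → T) : ℝ :=
  ent (prodM μ₀ μ) (fun p => (X₀ p.1 + A p.2, C p.2)) - ent μ C - ent μ₀ X₀ / 2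
    - (ent μ (fun ω => (A ω, C ω)) - ent μ C) / 2

lemma DD_dist {n : ℕ} {Ω₀ Ω Ω' T : Type*} [Fintype Ω₀] [Fintype Ω] [Fintype Ω'] [Fintype T]
    (μ₀ : Ω₀ → ℝ) (X₀ : Ω₀ → VV n)
    {μ : Ω → ℝ} {A : Ω → VV n} {C : Ω → T} {ν : Ω' → ℝ} {A' : Ω' → VV n} {C' : Ω' → T}
    (h : ∀ s, pmass μ (fun ω => (A ω, C ω)) s = pmass ν (fun ω => (A' ω, C' ω)) s) :
    DD μ₀ X₀ μ A C = DD μ₀ X₀ ν A' C' := by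
  have h1 : ent μ C = ent ν C' := ent_dist (pmass_comp_congr h Prod.snd)
  have h2 := ent_dist h
  have h3 : ent (prodM μ₀ μ) (fun p => (X₀ p.1 + A p.2, C p.2))
      = ent (prodM μ₀ ν) (fun p => (X₀ p.1 + A' p.2, C' p.2)) := by
    refine ent_dist (pmass_comp_congr (X := fun p : Ω₀ × Ω => (X₀ p.1, (A p.2, C p.2)))
      (Y := fun p : Ω₀ × Ω' => (X₀ p.1, (A' p.2, C' p.2))) ?_
      (fun q : VV n × (VV n × T) => (q.1 + q.2.1, q.2.2)))
    rintro ⟨x, y⟩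
    rw [pmass_prodM μ₀ μ X₀ (fun ω => (A ω, C ω)), pmass_prodM μ₀ ν X₀ (fun ω => (A' ω, C' ω)), h]
  unfold DD
  rw [h1, h2, h3]

lemma ent_unit {Ω : Type*} [Fintype Ω] {μ : Ω → ℝ} (hμ : IsProb μ) :
    ent μ (fun _ => ()) = 0 := by
  rw [ent_eq_sum]
  have : pmass μ (fun _ => ()) () = 1 := by unfold pmass; simp [hμ.2]
  simp [this]

/-- (P1) -/
lemma DD_cond {n : ℕ} {Ω₀ Ω T U : Type*} [Fintype Ω₀] [Fintype Ω] [Fintype T] [Fintype U]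
    {μ₀ : Ω₀ → ℝ} (h₀ : IsProb μ₀) (X₀ : Ω₀ → VV n)
    {μ : Ω → ℝ} (hμ : IsProb μ) (A : Ω → VV n) (E : Ω → U) (C : Ω → T) :
    DD μ₀ X₀ μ A (fun ω => (E ω, C ω)) ≤ DD μ₀ X₀ μ A C
      + (ent μ (fun ω => (A ω, C ω)) - ent μ C - ent μ (fun ω => (A ω, E ω, C ω))
        + ent μ (fun ω => (E ω, C ω))) / 2 := by
  have h := submod (prodM_prob h₀ hμ).1 (fun p => X₀ p.1 + A p.2) (fun p => E p.2) (fun p => C p.2)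
  have e1 : ent (prodM μ₀ μ) (fun p => C p.2) = ent μ C :=
    ent_dist (pmass_prodM_snd μ h₀ C)
  have e2 : ent (prodM μ₀ μ) (fun p => (E p.2, C p.2)) = ent μ (fun ω => (E ω, C ω)) :=
    ent_dist (pmass_prodM_snd μ h₀ (fun ω => (E ω, C ω)))
  unfold DD
  linarith

/-- (P2) -/
lemma DD_add {n : ℕ} {Ω₀ Ω : Type*} [Fintype Ω₀] [Fintype Ω]
    {μ₀ : Ω₀ → ℝ} (h₀ : IsProb μ₀) (X₀ : Ω₀ → VV n)
    {μ : Ω → ℝ} (hμ : IsProb μ) (Y Z : Ω → VV n) (hi : IndepPair μ Y Z) :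
    DD μ₀ X₀ μ (fun ω => Y ω + Z ω) (fun _ => ()) ≤ DD μ₀ X₀ μ Y (fun _ => ())
      + (ent μ (fun ω => Y ω + Z ω) - ent μ Y) / 2 := by
  have hp := prodM_prob h₀ hμ
  have h := submod hp.1 (fun p => X₀ p.1) (fun p => Z p.2) (fun p => X₀ p.1 + (Y p.2 + Z p.2))
  have u := ent_unit hμ
  have i1 := ind_ent hp.1 (ind_prodM h₀ hμ X₀ (fun ω => (Y ω, Z ω)))
  have i2 := ind_ent hp.1 (ind_prodM h₀ hμ X₀ (fun ω => Y ω + Z ω))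
  have i3 := ind_ent hμ.1 hi
  have e0 : ent (prodM μ₀ μ) (fun p => X₀ p.1) = ent μ₀ X₀ :=
    ent_dist (pmass_prodM_fst μ₀ hμ X₀)
  have e1 : ent (prodM μ₀ μ) (fun p => (Y p.2, Z p.2)) = ent μ (fun ω => (Y ω, Z ω)) :=
    ent_dist (pmass_prodM_snd μ h₀ (fun ω => (Y ω, Z ω)))
  have e2 : ent (prodM μ₀ μ) (fun p => Y p.2 + Z p.2) = ent μ (fun ω => Y ω + Z ω) :=
    ent_dist (pmass_prodM_snd μ h₀ (fun ω => Y ω + Z ω))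
  have hZ : ent (prodM μ₀ μ) (fun p => Z p.2) = ent μ Z :=
    ent_dist (pmass_prodM_snd μ h₀ Z)
  have i4 : IndepPair (prodM μ₀ μ) (fun p => Z p.2) (fun p => X₀ p.1 + Y p.2) := by
    have : IndepPair (prodM μ₀ μ) (fun p => Z p.2) (fun p => (X₀ p.1, Y p.2)) := by
      rintro z ⟨x, y⟩
      have a1 : pmass (prodM μ₀ μ) (fun p => (Z p.2, X₀ p.1, Y p.2)) (z, x, y)
          = pmass (prodM μ₀ μ) (fun p => (X₀ p.1, (Y p.2, Z p.2))) (x, (y, z)) :=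
        pmass_congr _ fun ω => by simp only [Prod.mk.injEq]; tauto
      rw [a1, pmass_prodM μ₀ μ X₀ (fun ω => (Y ω, Z ω)), pmass_prodM μ₀ μ X₀ Y,
        pmass_prodM_snd μ h₀ Z, hi]
      ring
    exact ind_comp this id (fun q => q.1 + q.2)
  have i5 := ind_ent hp.1 i4
  have c1 : ent (prodM μ₀ μ) (fun p => (X₀ p.1, Z p.2, X₀ p.1 + (Y p.2 + Z p.2)))
      = ent (prodM μ₀ μ) (fun p => (X₀ p.1, (Y p.2, Z p.2))) :=
    ent_congr _ fun p q => by simp only [Prod.mk.injEq]; grind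
  have c2 : ent (prodM μ₀ μ) (fun p => (X₀ p.1, X₀ p.1 + (Y p.2 + Z p.2)))
      = ent (prodM μ₀ μ) (fun p => (X₀ p.1, Y p.2 + Z p.2)) :=
    ent_congr _ fun p q => by simp only [Prod.mk.injEq]; grind
  have c3 : ent (prodM μ₀ μ) (fun p => (Z p.2, X₀ p.1 + (Y p.2 + Z p.2)))
      = ent (prodM μ₀ μ) (fun p => (Z p.2, X₀ p.1 + Y p.2)) :=
    ent_congr _ fun p q => by simp only [Prod.mk.injEq]; grind
  have c4 : ent (prodM μ₀ μ) (fun p => (X₀ p.1 + (Y p.2 + Z p.2), ()))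
      = ent (prodM μ₀ μ) (fun p => X₀ p.1 + (Y p.2 + Z p.2)) :=
    ent_congr _ fun p q => by simp only [Prod.mk.injEq, and_true]
  have c5 : ent (prodM μ₀ μ) (fun p => (X₀ p.1 + Y p.2, ()))
      = ent (prodM μ₀ μ) (fun p => X₀ p.1 + Y p.2) :=
    ent_congr _ fun p q => by simp only [Prod.mk.injEq, and_true]
  have c6 : ent μ (fun ω => (Y ω + Z ω, ())) = ent μ (fun ω => Y ω + Z ω) :=
    ent_congr _ fun p q => by simp only [Prod.mk.injEq, and_true]
  have c7 : ent μ (fun ω => (Y ω, ())) = ent μ Y :=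
    ent_congr _ fun p q => by simp only [Prod.mk.injEq, and_true]
  unfold DD
  rw [c4, c5, c6, c7]
  linarith

/-- (P5) -/
lemma DD_shift {n : ℕ} {Ω₀ Ω T : Type*} [Fintype Ω₀] [Fintype Ω]
    (μ₀ : Ω₀ → ℝ) (X₀ : Ω₀ → VV n)
    (μ : Ω → ℝ) (A B : Ω → VV n) (C : Ω → T) (f : T → VV n) (h : ∀ ω, B ω = A ω + f (C ω)) :
    DD μ₀ X₀ μ A C = DD μ₀ X₀ μ B C := by
  unfold DD
  have e1 : ent (prodM μ₀ μ) (fun p => (X₀ p.1 + A p.2, C p.2))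
      = ent (prodM μ₀ μ) (fun p => (X₀ p.1 + B p.2, C p.2)) :=
    ent_congr _ fun p q => by simp only [Prod.mk.injEq, h]; grind
  have e2 : ent μ (fun p => (A p, C p)) = ent μ (fun p => (B p, C p)) :=
    ent_congr _ fun p q => by simp only [Prod.mk.injEq, h]; grind
  rw [e1, e2]

lemma condMeas_prodM {Ω₀ Ω T : Type*} [Fintype Ω₀] [Fintype Ω]
    {μ₀ : Ω₀ → ℝ} (h₀ : IsProb μ₀) (μ : Ω → ℝ) (C : Ω → T) (c : T) :
    condMeas (prodM μ₀ μ) (fun p => C p.2) c = prodM μ₀ (condMeas μ C c) := by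
  funext p
  unfold condMeas
  rw [pmass_prodM_snd μ h₀ C c]
  unfold prodM
  split_ifs with h <;> simp [h, mul_div_assoc]

lemma DD_chain {n : ℕ} {Ω₀ Ω T : Type*} [Fintype Ω₀] [Fintype Ω] [Fintype T]
    {μ₀ : Ω₀ → ℝ} (h₀ : IsProb μ₀) (X₀ : Ω₀ → VV n)
    {μ : Ω → ℝ} (hμ : IsProb μ) (A : Ω → VV n) (C : Ω → T) :
    ∑ c, pmass μ C c * rdist μ₀ X₀ (condMeas μ C c) A = DD μ₀ X₀ μ A C := by
  have h1 := chain_rule (prodM_prob h₀ hμ).1 (fun p => X₀ p.1 + A p.2) (fun p => C p.2)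
  have h2 := chain_rule hμ.1 A C
  simp only [condMeas_prodM h₀, pmass_prodM_snd μ h₀ C] at h1
  have e1 : ent (prodM μ₀ μ) (fun p => C p.2) = ent μ C :=
    ent_dist (pmass_prodM_snd μ h₀ C)
  have h3 : ∀ c, pmass μ C c * rdist μ₀ X₀ (condMeas μ C c) A
      = pmass μ C c * ent (prodM μ₀ (condMeas μ C c)) (fun p => X₀ p.1 + A p.2)
        - pmass μ C c * (ent μ₀ X₀ / 2) - pmass μ C c * ent (condMeas μ C c) A / 2 := by
    intro c
    unfold rdist
    simp only [vv_sub]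
    unfold prodM
    ring
  simp only [h3, Finset.sum_sub_distrib, ← Finset.sum_mul, ← Finset.sum_div]
  rw [h1, h2, sum_pmass, hμ.2, e1]
  unfold DD
  ring

/-- The key property following from minimality. -/
def Hyp {n : ℕ} {Ω₀₁ Ω₀₂ : Type} [Fintype Ω₀₁] [Fintype Ω₀₂] (μ₀₁ : Ω₀₁ → ℝ) (μ₀₂ : Ω₀₂ → ℝ)
    (X₀₁ : Ω₀₁ → VV n) (X₀₂ : Ω₀₂ → VV n) (τ : ℝ) : Prop :=
  ∀ (Ω T : Type) [Fintype Ω] [Fintype T] (μ : Ω → ℝ) (A B : Ω → VV n) (C : Ω → T),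
    IsProb μ → CI μ A B C →
    τ ≤ ent μ (fun ω => (A ω + B ω, C ω)) - ent μ (fun ω => (A ω, C ω)) / 2
      - ent μ (fun ω => (B ω, C ω)) / 2
      + (1/9) * DD μ₀₁ X₀₁ μ A C + (1/9) * DD μ₀₂ X₀₂ μ B C

lemma hyp_of {n : ℕ} {Ω₀₁ Ω₀₂ : Type} [Fintype Ω₀₁] [Fintype Ω₀₂] (μ₀₁ : Ω₀₁ → ℝ) (μ₀₂ : Ω₀₂ → ℝ)
    (X₀₁ : Ω₀₁ → VV n) (X₀₂ : Ω₀₂ → VV n) (τ : ℝ) (h₁ : IsProb μ₀₁) (h₂ : IsProb μ₀₂)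
    (h : ∀ (Ω : Type) [Fintype Ω] (μ : Ω → ℝ) (ν : Ω → ℝ) (A B : Ω → VV n), IsProb μ → IsProb ν →
      τ ≤ rdist μ A ν B + (1/9) * rdist μ₀₁ X₀₁ μ A + (1/9) * rdist μ₀₂ X₀₂ ν B) :
    Hyp μ₀₁ μ₀₂ X₀₁ X₀₂ τ := by
  intro Ω T _ _ μ A B C hμ hCI
  have key : ∀ c, pmass μ C c * τ ≤ pmass μ C c * ent (condMeas μ C c) (fun ω => A ω + B ω)
      - pmass μ C c * ent (condMeas μ C c) A / 2 - pmass μ C c * ent (condMeas μ C c) B / 2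
      + (1/9) * (pmass μ C c * rdist μ₀₁ X₀₁ (condMeas μ C c) A)
      + (1/9) * (pmass μ C c * rdist μ₀₂ X₀₂ (condMeas μ C c) B) := by
    intro c
    by_cases hc : pmass μ C c = 0
    · simp [hc]
    have hp := condMeas_prob hμ C c hc
    have h3 := h Ω _ _ A B hp hp
    have h4 : ent (prodM (condMeas μ C c) (condMeas μ C c)) (fun p => A p.1 + B p.2)
        = ent (condMeas μ C c) (fun ω => A ω + B ω) := by
      refine ent_dist (pmass_comp_congr (X := fun p : Ω × Ω => (A p.1, B p.2))
        (Y := fun ω => (A ω, B ω)) ?_ (fun q => q.1 + q.2))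
      rintro ⟨a, b⟩
      rw [pmass_prodM, pmass_condMeas, pmass_condMeas, pmass_condMeas]
      have e1 : pmass μ (fun ω => ((A ω, B ω), C ω)) ((a, b), c)
        = pmass μ (fun ω => (A ω, B ω, C ω)) (a, b, c) :=
        pmass_congr μ fun ω => by simp only [Prod.mk.injEq]; tauto
      rw [e1]
      have := hCI a b c
      field_simp
      linarith
    have h5 : rdist (condMeas μ C c) A (condMeas μ C c) B
        = ent (condMeas μ C c) (fun ω => A ω + B ω)
        - ent (condMeas μ C c) A / 2 - ent (condMeas μ C c) B / 2 := by
      rw [← h4]; unfold rdist; simp only [vv_sub]; unfold prodM; rfl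
    rw [h5] at h3
    have := mul_le_mul_of_nonneg_left h3 (pmass_nonneg' hμ.1 C c)
    linarith
  have hs := Finset.sum_le_sum (s := Finset.univ) fun c _ => key c
  simp only [Finset.sum_add_distrib, Finset.sum_sub_distrib, ← Finset.sum_mul, ← Finset.sum_div,
    ← Finset.mul_sum] at hs
  rw [chain_rule hμ.1, chain_rule hμ.1, chain_rule hμ.1, DD_chain h₁ X₀₁ hμ, DD_chain h₂ X₀₂ hμ,
    sum_pmass, hμ.2] at hs
  linarith

/-- trial space -/
structure Trial {Ω T : Type} (C : Ω → T) : Type where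
  val : Ω × Ω
  prop : C val.1 = C val.2

instance {Ω T : Type} [Fintype Ω] (C : Ω → T) : Fintype (Trial C) :=
  Fintype.ofInjective Trial.val (fun p q h => by cases p; cases q; cases h; rfl)

/-- conditionally independent trials measure -/
def trialM {Ω T : Type} [Fintype Ω] (μ : Ω → ℝ) (C : Ω → T) : Trial C → ℝ :=
  fun p => μ p.1.1 * μ p.1.2 / pmass μ C (C p.1.1)

lemma sum_trial {Ω T : Type} [Fintype Ω] (C : Ω → T) (g : Ω → Ω → ℝ) :
    ∑ p : Trial C, g p.1.1 p.1.2 = ∑ ω, ∑ ω', if C ω = C ω' then g ω ω' else 0 := by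
  rw [← Fintype.sum_prod_type (f := fun p : Ω × Ω => if C p.1 = C p.2 then g p.1 p.2 else 0),
    ← Finset.sum_filter]
  refine Finset.sum_bij (fun p _ => p.1) (fun p _ => by simp [p.2])
    (fun p _ q _ h => by cases p; cases q; cases h; rfl) (fun b hb => ?_) (fun _ _ => rfl)
  exact ⟨⟨b, (Finset.mem_filter.1 hb).2⟩, Finset.mem_univ _, rfl⟩

lemma trial_fst {Ω T S : Type} [Fintype Ω] {μ : Ω → ℝ} (hμ : IsProb μ) (C : Ω → T) (F : Ω → S)
    (s : S) : pmass (trialM μ C) (fun p => F p.1.1) s = pmass μ F s := by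
  have h := sum_trial C (fun ω ω' => if F ω = s then μ ω * μ ω' / pmass μ C (C ω) else 0)
  conv_lhs => unfold pmass trialM
  conv_rhs => unfold pmass
  rw [h]
  refine Finset.sum_congr rfl fun ω _ => ?_
  by_cases hs : F ω = s
  · simp only [hs, if_true]
    have e : ∀ ω', (if C ω = C ω' then μ ω * μ ω' / pmass μ C (C ω) else 0)
        = μ ω / pmass μ C (C ω) * (if C ω' = C ω then μ ω' else 0) := by
      intro ω'
      by_cases h : C ω' = C ω
      · simp [h]; ring
      · simp [h, Ne.symm h]
    simp only [e]
    rw [← Finset.mul_sum]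
    change μ ω / pmass μ C (C ω) * pmass μ C (C ω) = μ ω
    rcases (hμ.1 ω).eq_or_lt with h0 | h0
    · simp [← h0]
    exact div_mul_cancel₀ _ (h0.trans_le (le_pmass hμ.1 C ω)).ne'
  · simp [hs]

lemma trial_snd {Ω T S : Type} [Fintype Ω] {μ : Ω → ℝ} (hμ : IsProb μ) (C : Ω → T) (F : Ω → S)
    (s : S) : pmass (trialM μ C) (fun p => F p.1.2) s = pmass μ F s := by
  rw [← trial_fst hμ C F s]
  have h1 := sum_trial C (fun ω ω' => if F ω = s then μ ω * μ ω' / pmass μ C (C ω) else 0)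
  have h2 := sum_trial C (fun ω ω' => if F ω' = s then μ ω * μ ω' / pmass μ C (C ω) else 0)
  unfold pmass trialM
  rw [h1, h2, Finset.sum_comm]
  refine Finset.sum_congr rfl fun ω _ => Finset.sum_congr rfl fun ω' _ => ?_
  by_cases h : C ω = C ω'
  · simp only [h, if_true, mul_comm]
  · simp [h, Ne.symm h]

lemma trial_prob {Ω T : Type} [Fintype Ω] {μ : Ω → ℝ} (hμ : IsProb μ) (C : Ω → T) :
    IsProb (trialM μ C) := by
  refine ⟨fun p => div_nonneg (mul_nonneg (hμ.1 _) (hμ.1 _)) (pmass_nonneg' hμ.1 _ _), ?_⟩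
  have := trial_fst hμ C (fun _ => ()) ()
  unfold pmass at this
  simpa [hμ.2] using this

lemma trial_CI {Ω T S S' : Type} [Fintype Ω] {μ : Ω → ℝ} (hμ : IsProb μ) (C : Ω → T) (F : Ω → S)
    (K : Ω → S') : CI (trialM μ C) (fun p => F p.1.1) (fun p => K p.1.2) (fun p => C p.1.1) := by
  intro a b c
  have e2 : pmass (trialM μ C) (fun p => (K p.1.2, C p.1.1)) (b, c)
      = pmass (trialM μ C) (fun p => (K p.1.2, C p.1.2)) (b, c) :=
    pmass_congr _ fun p => by rw [p.2]
  rw [e2, trial_snd hμ C (fun ω => (K ω, C ω)), trial_fst hμ C (fun ω => (F ω, C ω)),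
    trial_fst hμ C C]
  have h := sum_trial C (fun ω ω' => if (F ω, K ω', C ω) = (a, b, c) then
    μ ω * μ ω' / pmass μ C (C ω) else 0)
  have h' : pmass (trialM μ C) (fun p => (F p.1.1, K p.1.2, C p.1.1)) (a, b, c)
    = ∑ p : Trial C, if (F p.1.1, K p.1.2, C p.1.1) = (a, b, c) then
    μ p.1.1 * μ p.1.2 / pmass μ C (C p.1.1) else 0 := by
    rw [pmass]
    simp only [trialM]
    refine Finset.sum_congr rfl fun p _ => ?_
    split_ifs <;> rfl
  have h3 : pmass (trialM μ C) (fun p => (F p.1.1, K p.1.2, C p.1.1)) (a, b, c)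
      = pmass μ (fun ω => (F ω, C ω)) (a, c) * pmass μ (fun ω => (K ω, C ω)) (b, c)
        / pmass μ C c := by
    rw [h', h]
    conv_rhs => rw [div_eq_mul_inv]; enter [1]; unfold pmass
    rw [Finset.sum_mul_sum, Finset.sum_mul]
    refine Finset.sum_congr rfl fun ω _ => ?_
    rw [Finset.sum_mul]
    refine Finset.sum_congr rfl fun ω' _ => ?_
    by_cases hc : C ω = c
    · subst hc
      have h4 : (C ω = C ω') ↔ (C ω' = C ω) := eq_comm
      by_cases h1 : F ω = a <;> by_cases h2 : K ω' = b <;> by_cases h3 : C ω' = C ω <;>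
        simp [h1, h2, h4, h3, div_eq_mul_inv]
    · simp [hc]
  rw [h3]
  by_cases hc : pmass μ C c = 0
  · have : pmass μ (fun ω => (F ω, C ω)) (a, c) = 0 := by
      refine le_antisymm (hc ▸ ?_) (pmass_nonneg' hμ.1 _ _)
      unfold pmass
      refine Finset.sum_le_sum fun ω _ => ?_
      by_cases h1 : F ω = a <;> by_cases h2 : C ω = c <;> simp [h1, h2, hμ.1 ω]
    simp [this]
  · exact div_mul_cancel₀ _ hc

lemma bsg {n : ℕ} {Ω₀₁ Ω₀₂ : Type} [Fintype Ω₀₁] [Fintype Ω₀₂] {μ₀₁ : Ω₀₁ → ℝ} {μ₀₂ : Ω₀₂ → ℝ}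
    {X₀₁ : Ω₀₁ → VV n} {X₀₂ : Ω₀₂ → VV n} {τ : ℝ} (hyp : Hyp μ₀₁ μ₀₂ X₀₁ X₀₂ τ)
    (h₁ : IsProb μ₀₁) (h₂ : IsProb μ₀₂)
    {Ω T : Type} [Fintype Ω] [Fintype T] {μ : Ω → ℝ} (hμ : IsProb μ) (T₁ T₂ T₃ : Ω → VV n)
    (S : Ω → T) (hT : ∀ ω, T₁ ω + T₂ ω = T₃ ω) :
    τ ≤ 3 * (ent μ (fun ω => (T₁ ω, S ω)) + ent μ (fun ω => (T₂ ω, S ω)) - ent μ S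
        - ent μ (fun ω => (T₁ ω, T₂ ω, S ω)))
      + 2 * ent μ (fun ω => (T₃ ω, S ω)) - ent μ (fun ω => (T₁ ω, S ω))
      - ent μ (fun ω => (T₂ ω, S ω))
      + (1/9) * DD μ₀₁ X₀₁ μ T₁ S + (1/9) * DD μ₀₂ X₀₂ μ T₂ S
      + (1/18) * (ent μ (fun ω => (T₁ ω, S ω)) + ent μ (fun ω => (T₃ ω, S ω)) - ent μ S
        - ent μ (fun ω => (T₁ ω, T₂ ω, S ω)))
      + (1/18) * (ent μ (fun ω => (T₂ ω, S ω)) + ent μ (fun ω => (T₃ ω, S ω)) - ent μ S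
        - ent μ (fun ω => (T₁ ω, T₂ ω, S ω))) := by
  set C : Ω → VV n × T := fun ω => (T₃ ω, S ω) with hC
  set ν := trialM μ C with hν'
  have hν : IsProb ν := trial_prob hμ C
  have two := vv_two n
  have ci := trial_CI hμ C T₁ T₂
  have hh := hyp (Trial C) (VV n × T) ν (fun p => T₁ p.1.1) (fun p => T₂ p.1.2) (fun p => C p.1.1)
    hν ci
  have hci := ci.ent_eq hν.1
  have hT3 : ∀ p : Trial C, T₁ p.1.1 + T₂ p.1.1 = T₁ p.1.2 + T₂ p.1.2 := by
    intro p
    rw [hT, hT]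
    exact congrArg Prod.fst p.2
  have hS : ∀ p : Trial C, S p.1.1 = S p.1.2 := fun p => congrArg Prod.snd p.2
  -- transfers
  have t1 : ent ν (fun p => (T₁ p.1.1, C p.1.1)) = ent μ (fun ω => (T₁ ω, C ω)) :=
    ent_dist (trial_fst hμ C (fun ω => (T₁ ω, C ω)))
  have t2 : ent ν (fun p => (T₂ p.1.2, C p.1.1)) = ent μ (fun ω => (T₂ ω, C ω)) := by
    have : (fun p : Trial C => (T₂ p.1.2, C p.1.1)) = (fun p => (T₂ p.1.2, C p.1.2)) := by
      funext p; rw [p.2]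
    rw [this]
    exact ent_dist (trial_snd hμ C (fun ω => (T₂ ω, C ω)))
  have t3 : ent ν (fun p => C p.1.1) = ent μ C := ent_dist (trial_fst hμ C C)
  have t4 : ent ν (fun p => S p.1.1) = ent μ S := ent_dist (trial_fst hμ C S)
  have t5 : ent ν (fun p => (T₁ p.1.1, S p.1.1)) = ent μ (fun ω => (T₁ ω, S ω)) :=
    ent_dist (trial_fst hμ C (fun ω => (T₁ ω, S ω)))
  have t6 : ent ν (fun p => (T₂ p.1.1, S p.1.1)) = ent μ (fun ω => (T₂ ω, S ω)) :=
    ent_dist (trial_fst hμ C (fun ω => (T₂ ω, S ω)))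
  have t7 : ent ν (fun p => (T₁ p.1.2, S p.1.1)) = ent μ (fun ω => (T₁ ω, S ω)) := by
    simp only [hS]
    exact ent_dist (trial_snd hμ C (fun ω => (T₁ ω, S ω)))
  have t8 : ent ν (fun p => (T₂ p.1.2, S p.1.1)) = ent μ (fun ω => (T₂ ω, S ω)) := by
    simp only [hS]
    exact ent_dist (trial_snd hμ C (fun ω => (T₂ ω, S ω)))
  have t9 : DD μ₀₁ X₀₁ ν (fun p => T₁ p.1.1) (fun p => C p.1.1) = DD μ₀₁ X₀₁ μ T₁ C :=
    DD_dist _ _ (trial_fst hμ C (fun ω => (T₁ ω, C ω)))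
  have t10 : DD μ₀₂ X₀₂ ν (fun p => T₂ p.1.2) (fun p => C p.1.1) = DD μ₀₂ X₀₂ μ T₂ C := by
    have : (fun p : Trial C => C p.1.1) = (fun p => C p.1.2) := by
      funext p; rw [p.2]
    rw [this]
    exact DD_dist _ _ (trial_snd hμ C (fun ω => (T₂ ω, C ω)))
  have c1 : ent μ (fun ω => (T₁ ω, C ω)) = ent μ (fun ω => (T₁ ω, T₂ ω, S ω)) :=
    ent_congr _ fun p q => by simp only [hC, Prod.mk.injEq, ← hT]; grind
  have c2 : ent μ (fun ω => (T₂ ω, C ω)) = ent μ (fun ω => (T₁ ω, T₂ ω, S ω)) :=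
    ent_congr _ fun p q => by simp only [hC, Prod.mk.injEq, ← hT]; grind
  -- submodularity
  have s1 := submod hν.1 (fun p => T₁ p.1.1 + T₂ p.1.2) (fun p => T₃ p.1.1) (fun p => S p.1.1)
  have s2 := submod hν.1 (fun p => T₁ p.1.1) (fun p => T₂ p.1.1)
    (fun p => (T₁ p.1.1 + T₂ p.1.2, S p.1.1))
  have s3 := submod hν.1 (fun p => T₁ p.1.1) (fun p => T₂ p.1.2) (fun p => S p.1.1)
  have s4 := submod hν.1 (fun p => T₂ p.1.1) (fun p => T₁ p.1.2) (fun p => S p.1.1)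
  have d1 : ent ν (fun p => (T₁ p.1.1, T₂ p.1.1, T₁ p.1.1 + T₂ p.1.2, S p.1.1))
      = ent ν (fun p => (T₁ p.1.1, T₂ p.1.2, C p.1.1)) :=
    ent_congr _ fun p q => by simp only [hC, Prod.mk.injEq, ← hT]; grind
  have d2 : ent ν (fun p => (T₁ p.1.1, T₁ p.1.1 + T₂ p.1.2, S p.1.1))
      = ent ν (fun p => (T₁ p.1.1, T₂ p.1.2, S p.1.1)) :=
    ent_congr _ fun p q => by simp only [Prod.mk.injEq]; grind
  have d3 : ent ν (fun p => (T₂ p.1.1, T₁ p.1.1 + T₂ p.1.2, S p.1.1))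
      = ent ν (fun p => (T₂ p.1.1, T₁ p.1.2, S p.1.1)) := by
    have hx : ∀ p : Trial C, T₁ p.1.1 + T₂ p.1.2 = T₁ p.1.2 + T₂ p.1.1 := by
      intro p
      linear_combination hT3 p + (T₂ p.1.2 - T₂ p.1.1) * two
    refine ent_congr _ fun p q => ?_
    simp only [Prod.mk.injEq, hx]; grind
  have e1 := DD_cond h₁ X₀₁ hμ T₁ T₃ S
  have e2 := DD_cond h₂ X₀₂ hμ T₂ T₃ S
  simp only [← hC] at e1 e2
  have s1' : ent ν (fun p => (T₁ p.1.1 + T₂ p.1.2, C p.1.1)) + ent ν (fun p => S p.1.1) ≤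
    ent ν (fun p => (T₁ p.1.1 + T₂ p.1.2, S p.1.1)) + ent ν (fun p => C p.1.1) := s1
  have k1 : ent μ (fun ω => (T₁ ω, T₃ ω, S ω)) = ent μ (fun ω => (T₁ ω, C ω)) := rfl
  have k2 : ent μ (fun ω => (T₂ ω, T₃ ω, S ω)) = ent μ (fun ω => (T₂ ω, C ω)) := rfl
  have k3 : ent μ (fun ω => (T₃ ω, S ω)) = ent μ C := rfl
  have k4 : ent μ (fun ω => C ω) = ent μ C := rfl
  linarith

lemma pmass_unit {Ω : Type*} [Fintype Ω] {μ : Ω → ℝ} (hμ : IsProb μ) (u : Unit) :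
    pmass μ (fun _ => ()) u = 1 := by
  unfold pmass; simp [hμ.2]

lemma ind_CI_unit {Ω S T : Type*} [Fintype Ω] {μ : Ω → ℝ} (hμ : IsProb μ) {X : Ω → S} {Y : Ω → T}
    (h : IndepPair μ X Y) : CI μ X Y (fun _ => ()) := by
  intro a b c
  rw [pmass_unit hμ, mul_one]
  have e1 : pmass μ (fun ω => (X ω, Y ω, ())) (a, b, c) = pmass μ (fun ω => (X ω, Y ω)) (a, b) :=
    pmass_congr μ fun ω => by simp
  have e2 : pmass μ (fun ω => (X ω, ())) (a, c) = pmass μ X a :=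
    pmass_congr μ fun ω => by simp
  have e3 : pmass μ (fun ω => (Y ω, ())) (b, c) = pmass μ Y b :=
    pmass_congr μ fun ω => by simp
  rw [e1, e2, e3, h]

lemma ent_pair_unit {Ω S : Type*} [Fintype Ω] (μ : Ω → ℝ) (X : Ω → S) :
    ent μ (fun ω => (X ω, ())) = ent μ X :=
  ent_congr μ fun p q => by simp only [Prod.mk.injEq, and_true]

lemma DD_cond0 {n : ℕ} {Ω₀ Ω U : Type*} [Fintype Ω₀] [Fintype Ω] [Fintype U]
    {μ₀ : Ω₀ → ℝ} (h₀ : IsProb μ₀) (X₀ : Ω₀ → VV n)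
    {μ : Ω → ℝ} (hμ : IsProb μ) (A : Ω → VV n) (E : Ω → U) :
    DD μ₀ X₀ μ A E ≤ DD μ₀ X₀ μ A (fun _ => ())
      + (ent μ A - ent μ (fun ω => (A ω, E ω)) + ent μ E) / 2 := by
  have h := DD_cond h₀ X₀ hμ A E (fun _ => ())
  have e1 : ent μ (fun ω => (A ω, E ω, ())) = ent μ (fun ω => (A ω, E ω)) :=
    ent_congr μ fun p q => by simp only [Prod.mk.injEq, and_true]
  have e2 : ent (prodM μ₀ μ) (fun p => (X₀ p.1 + A p.2, E p.2, ()))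
      = ent (prodM μ₀ μ) (fun p => (X₀ p.1 + A p.2, E p.2)) :=
    ent_congr _ fun p q => by simp only [Prod.mk.injEq, and_true]
  have e3 : DD μ₀ X₀ μ A (fun ω => (E ω, ())) = DD μ₀ X₀ μ A E := by
    unfold DD
    rw [e1, e2, ent_pair_unit]
  rw [e3, e1, ent_pair_unit, ent_pair_unit, ent_unit hμ] at h
  linarith

lemma ind_symm {Ω S T : Type*} [Fintype Ω] {μ : Ω → ℝ} {X : Ω → S} {Y : Ω → T}
    (h : IndepPair μ X Y) : IndepPair μ Y X := by
  intro t s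
  rw [mul_comm, ← h s t]
  exact pmass_congr μ fun ω => by simp only [Prod.mk.injEq]; tauto

lemma ent_add_congr {n : ℕ} {Ω Ω' : Type*} [Fintype Ω] [Fintype Ω'] {μ : Ω → ℝ} {X Y : Ω → VV n}
    {ν : Ω' → ℝ} {X' Y' : Ω' → VV n}
    (h : IndepPair μ X Y) (h' : IndepPair ν X' Y') (hX : ∀ s, pmass μ X s = pmass ν X' s)
    (hY : ∀ s, pmass μ Y s = pmass ν Y' s) :
    ent μ (fun ω => X ω + Y ω) = ent ν (fun ω => X' ω + Y' ω) := by
  refine ent_dist (pmass_comp_congr (X := fun ω => (X ω, Y ω)) (Y := fun ω => (X' ω, Y' ω)) ?_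
    (fun q => q.1 + q.2))
  rintro ⟨a, b⟩
  rw [h, h', hX, hY]

lemma four_pairs {Ω S T U V : Type*} [Fintype Ω] [Fintype S] [Fintype T] [Fintype U] [Fintype V]
    {μ : Ω → ℝ} (hμ : IsProb μ) {X : Ω → S} {Y : Ω → T} {Z : Ω → U} {W : Ω → V}
    (h : IndepFour μ X Y Z W) : IndepPair μ X Y ∧ IndepPair μ Z W ∧
      IndepPair μ (fun ω => (X ω, Y ω)) (fun ω => (Z ω, W ω)) := by
  have e : ∀ x y z w, pmass μ (fun ω => ((X ω, Y ω), (Z ω, W ω))) ((x, y), (z, w))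
      = pmass μ X x * pmass μ Y y * (pmass μ Z z * pmass μ W w) := by
    intro x y z w
    rw [← mul_assoc, ← h x y z w]
    exact pmass_congr μ fun ω => by simp only [Prod.mk.injEq]; tauto
  have h1 : IndepPair μ X Y := by
    intro x y
    rw [← pmass_fst μ (fun ω => (X ω, Y ω)) (fun ω => (Z ω, W ω)) (x, y), Fintype.sum_prod_type]
    simp only [e]
    simp only [← Finset.mul_sum, sum_pmass, hμ.2, mul_one]
  have h2 : IndepPair μ Z W := by
    intro z w
    rw [← pmass_snd μ (fun ω => (X ω, Y ω)) (fun ω => (Z ω, W ω)) (z, w), Fintype.sum_prod_type]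
    simp only [e]
    simp only [← Finset.mul_sum, ← Finset.sum_mul, sum_pmass, hμ.2, mul_one, one_mul]
  refine ⟨h1, h2, ?_⟩
  rintro ⟨x, y⟩ ⟨z, w⟩
  rw [e, h1, h2]

lemma four_cycle {Ω S T U V : Type*} [Fintype Ω]
    {μ : Ω → ℝ} {X : Ω → S} {Y : Ω → T} {Z : Ω → U} {W : Ω → V}
    (h : IndepFour μ X Y Z W) : IndepFour μ X W Y Z := by
  intro x w y z
  have := h x y z w
  rw [pmass_congr μ (Y := fun ω => (X ω, Y ω, Z ω, W ω)) (t := (x, y, z, w))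
    (fun ω => by simp only [Prod.mk.injEq]; tauto), this]
  ring

lemma pairing {n : ℕ} {Ω₀₁ Ω₀₂ : Type} [Fintype Ω₀₁] [Fintype Ω₀₂] {μ₀₁ : Ω₀₁ → ℝ} {μ₀₂ : Ω₀₂ → ℝ}
    {X₀₁ : Ω₀₁ → VV n} {X₀₂ : Ω₀₂ → VV n} {τ : ℝ} (hyp : Hyp μ₀₁ μ₀₂ X₀₁ X₀₂ τ)
    (h₁ : IsProb μ₀₁) (h₂ : IsProb μ₀₂)
    {Ω : Type} [Fintype Ω] {μ : Ω → ℝ} (hμ : IsProb μ) (x x' y y' : Ω → VV n)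
    (hx : IndepPair μ x x') (hy : IndepPair μ y y')
    (hxy : IndepPair μ (fun ω => (x ω, x' ω)) (fun ω => (y ω, y' ω))) :
    τ ≤ ent μ (fun ω => (x ω + x' ω) + (y ω + y' ω)) - ent μ (fun ω => x ω + x' ω) / 2
      - ent μ (fun ω => y ω + y' ω) / 2
      + (1/9) * (DD μ₀₁ X₀₁ μ x (fun _ => ()) + (ent μ (fun ω => x ω + x' ω) - ent μ x) / 2)
      + (1/9) * (DD μ₀₂ X₀₂ μ y (fun _ => ()) + (ent μ (fun ω => y ω + y' ω) - ent μ y) / 2) ∧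
    τ ≤ ent μ (fun ω => (x ω + y ω, x ω + x' ω, y ω + y' ω))
      - (ent μ x + ent μ x' + ent μ (fun ω => y ω + y' ω)) / 2
      - (ent μ y + ent μ y' + ent μ (fun ω => x ω + x' ω)) / 2
      + (1/9) * (DD μ₀₁ X₀₁ μ x (fun _ => ()) + (ent μ (fun ω => x ω + x' ω) - ent μ x') / 2)
      + (1/9) * (DD μ₀₂ X₀₂ μ y (fun _ => ()) + (ent μ (fun ω => y ω + y' ω) - ent μ y') / 2) := by
  have i1 := ind_comp hxy (fun q => q.1 + q.2) (fun q => q.1 + q.2)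
  have i2 := ind_comp hxy id (fun q => q.1 + q.2)
  have i3 := ind_comp hxy (fun q => q.1 + q.2) id
  dsimp only [id] at i1 i2 i3
  have j1 := ind_ent hμ.1 i1
  have j2 := ind_ent hμ.1 i2
  have j3 := ind_ent hμ.1 i3
  have j4 := ind_ent hμ.1 hx
  have j5 := ind_ent hμ.1 hy
  constructor
  · have h := hyp Ω Unit μ _ _ _ hμ (ind_CI_unit hμ i1)
    have a1 := DD_add h₁ X₀₁ hμ x x' hx
    have a2 := DD_add h₂ X₀₂ hμ y y' hy
    rw [ent_pair_unit, ent_pair_unit, ent_pair_unit] at h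
    linarith
  · have ci : CI μ x y (fun ω => (x ω + x' ω, y ω + y' ω)) :=
      ind_CI (ind_comp hxy (fun q => (q.1, q.1 + q.2)) (fun q => (q.1, q.1 + q.2)))
    have h := hyp Ω _ μ _ _ _ hμ ci
    have a1 := DD_cond0 h₁ X₀₁ hμ x (fun ω => (x ω + x' ω, y ω + y' ω))
    have a2 := DD_cond0 h₂ X₀₂ hμ y (fun ω => (x ω + x' ω, y ω + y' ω))
    have c1 : ent μ (fun ω => (x ω, x ω + x' ω, y ω + y' ω))
        = ent μ (fun ω => ((x ω, x' ω), y ω + y' ω)) :=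
      ent_congr _ fun p q => by simp only [Prod.mk.injEq]; grind
    have c2 : ent μ (fun ω => (y ω, x ω + x' ω, y ω + y' ω))
        = ent μ (fun ω => (x ω + x' ω, y ω, y' ω)) :=
      ent_congr _ fun p q => by simp only [Prod.mk.injEq]; grind
    rw [c1] at h a1
    rw [c2] at h a2
    linarith

lemma main_false {n : ℕ} {Ω₀₁ Ω₀₂ : Type} [Fintype Ω₀₁] [Fintype Ω₀₂] {μ₀₁ : Ω₀₁ → ℝ}
    {μ₀₂ : Ω₀₂ → ℝ}
    {X₀₁ : Ω₀₁ → VV n} {X₀₂ : Ω₀₂ → VV n} {τ : ℝ} (hyp : Hyp μ₀₁ μ₀₂ X₀₁ X₀₂ τ)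
    (h₁ : IsProb μ₀₁) (h₂ : IsProb μ₀₂)
    {Ω : Type} [Fintype Ω] {μ : Ω → ℝ} (hμ : IsProb μ) (a b c d : Ω → VV n)
    (h4 : IndepFour μ a b c d) (hac : ∀ s, pmass μ a s = pmass μ c s)
    (hbd : ∀ s, pmass μ b s = pmass μ d s)
    (hk : 0 < ent μ (fun ω => a ω + b ω) - ent μ a / 2 - ent μ b / 2)
    (hτ : τ = ent μ (fun ω => a ω + b ω) - ent μ a / 2 - ent μ b / 2
      + (1/9) * DD μ₀₁ X₀₁ μ a (fun _ => ()) + (1/9) * DD μ₀₂ X₀₂ μ b (fun _ => ())) : False := by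
  have two := vv_two n
  obtain ⟨iab, icd, iabcd⟩ := four_pairs hμ h4
  obtain ⟨iad, ibc, iadbc⟩ := four_pairs hμ (four_cycle h4)
  obtain ⟨iac, idb, iacdb⟩ := four_pairs hμ (four_cycle (four_cycle h4))
  have ibd := ind_symm idb
  have icb := ind_symm ibc
  have iacbd := ind_comp iacdb id (fun q => (q.2, q.1))
  dsimp only [id] at iacbd
  have hca := fun s => (hac s).symm
  have hdb := fun s => (hbd s).symm
  -- entropies
  have n1 : ent μ c = ent μ a := ent_dist hca
  have n2 : ent μ d = ent μ b := ent_dist hdb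
  have n3 : ent μ (fun ω => c ω + d ω) = ent μ (fun ω => a ω + b ω) :=
    ent_add_congr icd iab hca hdb
  have n4 : ent μ (fun ω => c ω + b ω) = ent μ (fun ω => a ω + b ω) :=
    ent_add_congr icb iab hca (fun _ => rfl)
  have n5 : ent μ (fun ω => a ω + d ω) = ent μ (fun ω => a ω + b ω) :=
    ent_add_congr iad iab (fun _ => rfl) hdb
  have n6 : ent μ (fun ω => b ω + c ω) = ent μ (fun ω => a ω + b ω) := by
    rw [← n4]; simp only [add_comm]
  obtain ⟨p1, p2⟩ := pairing hyp h₁ h₂ hμ a d b c iad ibc iadbc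
  obtain ⟨p3, p4⟩ := pairing hyp h₁ h₂ hμ a c b d iac ibd iacbd
  have S1 : ent μ (fun ω => (a ω + d ω) + (b ω + c ω)) = ent μ (fun ω => a ω + b ω + c ω + d ω) := by
    congr 1; funext ω; ring
  have S2 : ent μ (fun ω => (a ω + c ω) + (b ω + d ω)) = ent μ (fun ω => a ω + b ω + c ω + d ω) := by
    congr 1; funext ω; ring
  -- joint with S
  have u1 : ent μ (fun ω => (a ω + b ω, a ω + b ω + c ω + d ω))
      = ent μ (fun ω => a ω + b ω) + ent μ (fun ω => c ω + d ω) := by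
    rw [← ind_ent hμ.1 (ind_comp iabcd (fun q => q.1 + q.2) (fun q => q.1 + q.2))]
    exact ent_congr _ fun p q => by simp only [Prod.mk.injEq]; grind
  have u2 : ent μ (fun ω => (c ω + b ω, a ω + b ω + c ω + d ω))
      = ent μ (fun ω => a ω + d ω) + ent μ (fun ω => b ω + c ω) := by
    rw [← ind_ent hμ.1 (ind_comp iadbc (fun q => q.1 + q.2) (fun q => q.1 + q.2))]
    exact ent_congr _ fun p q => by simp only [Prod.mk.injEq]; grind
  have u3 : ent μ (fun ω => (a ω + c ω, a ω + b ω + c ω + d ω))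
      = ent μ (fun ω => a ω + c ω) + ent μ (fun ω => b ω + d ω) := by
    rw [← ind_ent hμ.1 (ind_comp iacbd (fun q => q.1 + q.2) (fun q => q.1 + q.2))]
    exact ent_congr _ fun p q => by simp only [Prod.mk.injEq]; grind
  have u4 : ent μ (fun ω => (b ω + d ω, a ω + b ω + c ω + d ω))
      = ent μ (fun ω => a ω + c ω) + ent μ (fun ω => b ω + d ω) := by
    rw [← ind_ent hμ.1 (ind_comp iacbd (fun q => q.1 + q.2) (fun q => q.1 + q.2))]
    exact ent_congr _ fun p q => by simp only [Prod.mk.injEq]; grind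
  -- triples
  have t1 : ent μ (fun ω => (a ω + b ω, a ω + d ω, b ω + c ω))
      = ent μ (fun ω => (a ω + b ω, c ω + b ω, a ω + b ω + c ω + d ω)) :=
    ent_congr _ fun p q => by simp only [Prod.mk.injEq]; grind
  have t2 : ent μ (fun ω => (a ω + b ω, a ω + c ω, b ω + d ω))
      = ent μ (fun ω => (a ω + b ω, c ω + b ω, a ω + b ω + c ω + d ω)) :=
    ent_congr _ fun p q => by simp only [Prod.mk.injEq]; grind
  have t3 : ent μ (fun ω => (c ω + b ω, a ω + c ω, a ω + b ω + c ω + d ω))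
      = ent μ (fun ω => (a ω + b ω, c ω + b ω, a ω + b ω + c ω + d ω)) :=
    ent_congr _ fun p q => by simp only [Prod.mk.injEq]; grind
  have t4 : ent μ (fun ω => (a ω + c ω, a ω + b ω, a ω + b ω + c ω + d ω))
      = ent μ (fun ω => (a ω + b ω, c ω + b ω, a ω + b ω + c ω + d ω)) :=
    ent_congr _ fun p q => by simp only [Prod.mk.injEq]; grind
  -- bsg
  have B1 := bsg hyp h₁ h₂ hμ (fun ω => a ω + b ω) (fun ω => c ω + b ω) (fun ω => a ω + c ω)
    (fun ω => a ω + b ω + c ω + d ω) (fun ω => by linear_combination (b ω) * two)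
  have B2 := bsg hyp h₁ h₂ hμ (fun ω => c ω + b ω) (fun ω => a ω + c ω) (fun ω => a ω + b ω)
    (fun ω => a ω + b ω + c ω + d ω) (fun ω => by linear_combination (c ω) * two)
  have B3 := bsg hyp h₁ h₂ hμ (fun ω => a ω + c ω) (fun ω => a ω + b ω) (fun ω => c ω + b ω)
    (fun ω => a ω + b ω + c ω + d ω) (fun ω => by linear_combination (a ω) * two)
  -- distances
  have hDc : DD μ₀₁ X₀₁ μ c (fun _ => ()) = DD μ₀₁ X₀₁ μ a (fun _ => ()) := by
    refine DD_dist _ _ fun s => ?_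
    exact pmass_comp_congr hca (fun x => (x, ())) s
  have D1U := DD_add h₁ X₀₁ hμ a b iab
  have D1V := DD_add h₁ X₀₁ hμ c b icb
  have D1W := DD_add h₁ X₀₁ hμ a c iac
  have D2U := DD_add h₂ X₀₂ hμ b a (ind_symm iab)
  have D2V := DD_add h₂ X₀₂ hμ b c ibc
  have D2W := DD_add h₂ X₀₂ hμ b d ibd
  have f1 : (fun ω => b ω + a ω) = fun ω => a ω + b ω := by funext ω; ring
  have f2 : (fun ω => b ω + c ω) = fun ω => c ω + b ω := by funext ω; ring
  rw [f1] at D2U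
  rw [f2] at D2V
  have E1U := DD_cond0 h₁ X₀₁ hμ (fun ω => a ω + b ω) (fun ω => a ω + b ω + c ω + d ω)
  have E1V := DD_cond0 h₁ X₀₁ hμ (fun ω => c ω + b ω) (fun ω => a ω + b ω + c ω + d ω)
  have E1W := DD_cond0 h₁ X₀₁ hμ (fun ω => a ω + c ω) (fun ω => a ω + b ω + c ω + d ω)
  have E2U := DD_cond0 h₂ X₀₂ hμ (fun ω => a ω + b ω) (fun ω => a ω + b ω + c ω + d ω)
  have E2V := DD_cond0 h₂ X₀₂ hμ (fun ω => c ω + b ω) (fun ω => a ω + b ω + c ω + d ω)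
  have E2W := DD_cond0 h₂ X₀₂ hμ (fun ω => b ω + d ω) (fun ω => a ω + b ω + c ω + d ω)
  have sh := DD_shift μ₀₂ X₀₂ μ (fun ω => a ω + c ω) (fun ω => b ω + d ω)
    (fun ω => a ω + b ω + c ω + d ω) id
    (fun ω => by simp only [id]; linear_combination (- a ω - c ω) * two)
  simp only [S1, S2, u1, u2, u3, u4, t1, t2, t3, t4, n1, n2, n3, n4, n5, n6, hDc, sh] at *
  generalize ent μ (fun ω => a ω + b ω) = hU at *
  generalize ent μ (fun ω => a ω + c ω) = h11 at *
  generalize ent μ (fun ω => b ω + d ω) = h22 at *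
  generalize ent μ (fun ω => a ω + b ω + c ω + d ω) = hS at *
  generalize ent μ (fun ω => (a ω + b ω, c ω + b ω, a ω + b ω + c ω + d ω)) = hE at *
  generalize ent μ a = ha at *
  generalize ent μ b = hb at *
  linarith

/-- **The main inductive step (Proposition 2.2).** With `η = 1/9` and
`τ[X₁; X₂] := d[X₁; X₂] + η d[X₁⁰; X₁] + η d[X₂⁰; X₂]`: if `d[X₁; X₂] > 0` then there
are finitely supported `G`-valued random variables `X₁', X₂'` with
`τ[X₁'; X₂'] < τ[X₁; X₂]`. -/
theorem tau_decrement {n : ℕ} {Ω₀₁ Ω₀₂ Ω₁ Ω₂ : Type}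
    [Fintype Ω₀₁] [Fintype Ω₀₂] [Fintype Ω₁] [Fintype Ω₂]
    (μ₀₁ : Ω₀₁ → ℝ) (μ₀₂ : Ω₀₂ → ℝ) (μ₁ : Ω₁ → ℝ) (μ₂ : Ω₂ → ℝ)
    (hμ₀₁ : IsProb μ₀₁) (hμ₀₂ : IsProb μ₀₂) (hμ₁ : IsProb μ₁) (hμ₂ : IsProb μ₂)
    (X₀₁ : Ω₀₁ → (Fin n → ZMod 2)) (X₀₂ : Ω₀₂ → (Fin n → ZMod 2))
    (X₁ : Ω₁ → (Fin n → ZMod 2)) (X₂ : Ω₂ → (Fin n → ZMod 2))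
    (hpos : 0 < rdist μ₁ X₁ μ₂ X₂) :
    ∃ (Ω₁' : Type) (_ : Fintype Ω₁') (Ω₂' : Type) (_ : Fintype Ω₂')
      (μ₁' : Ω₁' → ℝ) (μ₂' : Ω₂' → ℝ)
      (X₁' : Ω₁' → (Fin n → ZMod 2)) (X₂' : Ω₂' → (Fin n → ZMod 2)),
      IsProb μ₁' ∧ IsProb μ₂' ∧
      rdist μ₁' X₁' μ₂' X₂' + (1/9) * rdist μ₀₁ X₀₁ μ₁' X₁'
          + (1/9) * rdist μ₀₂ X₀₂ μ₂' X₂'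
        < rdist μ₁ X₁ μ₂ X₂ + (1/9) * rdist μ₀₁ X₀₁ μ₁ X₁
          + (1/9) * rdist μ₀₂ X₀₂ μ₂ X₂ := by
  by_contra hcon
  have hmin : ∀ (Ω : Type) [Fintype Ω] (μ : Ω → ℝ) (ν : Ω → ℝ) (A B : Ω → VV n),
      IsProb μ → IsProb ν →
      rdist μ₁ X₁ μ₂ X₂ + (1/9) * rdist μ₀₁ X₀₁ μ₁ X₁ + (1/9) * rdist μ₀₂ X₀₂ μ₂ X₂
        ≤ rdist μ A ν B + (1/9) * rdist μ₀₁ X₀₁ μ A + (1/9) * rdist μ₀₂ X₀₂ ν B := by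
    intro Ω _ μ ν A B hμ hν
    by_contra hlt
    exact hcon ⟨Ω, inferInstance, Ω, inferInstance, μ, ν, A, B, hμ, hν, not_le.1 hlt⟩
  have hyp := hyp_of μ₀₁ μ₀₂ X₀₁ X₀₂ _ hμ₀₁ hμ₀₂ hmin
  have hm2 := prodM_prob hμ₁ hμ₂
  have hm3 := prodM_prob hμ₂ hm2
  have hm4 := prodM_prob hμ₁ hm3
  set M := prodM μ₁ (prodM μ₂ (prodM μ₁ μ₂)) with hM
  have pa : ∀ s, pmass M (fun p => X₁ p.1) s = pmass μ₁ X₁ s := pmass_prodM_fst μ₁ hm3 X₁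
  have pb : ∀ s, pmass M (fun p => X₂ p.2.1) s = pmass μ₂ X₂ s := fun s =>
    (pmass_prodM_snd (prodM μ₂ (prodM μ₁ μ₂)) hμ₁ (fun q => X₂ q.1) s).trans (pmass_prodM_fst μ₂ hm2 X₂ s)
  have pc : ∀ s, pmass M (fun p => X₁ p.2.2.1) s = pmass μ₁ X₁ s := fun s =>
    ((pmass_prodM_snd (prodM μ₂ (prodM μ₁ μ₂)) hμ₁ (fun q => X₁ q.2.1) s).trans
      (pmass_prodM_snd (prodM μ₁ μ₂) hμ₂ (fun q => X₁ q.1) s)).trans (pmass_prodM_fst μ₁ hμ₂ X₁ s)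
  have pd : ∀ s, pmass M (fun p => X₂ p.2.2.2) s = pmass μ₂ X₂ s := fun s =>
    ((pmass_prodM_snd (prodM μ₂ (prodM μ₁ μ₂)) hμ₁ (fun q => X₂ q.2.2) s).trans
      (pmass_prodM_snd (prodM μ₁ μ₂) hμ₂ (fun q => X₂ q.2) s)).trans (pmass_prodM_snd μ₂ hμ₁ X₂ s)
  have h4 : IndepFour M (fun p => X₁ p.1) (fun p => X₂ p.2.1) (fun p => X₁ p.2.2.1)
      (fun p => X₂ p.2.2.2) := by
    intro s t u v
    rw [pa, pb, pc, pd, hM, pmass_prodM μ₁ (prodM μ₂ (prodM μ₁ μ₂)) X₁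
      (fun q => (X₂ q.1, X₁ q.2.1, X₂ q.2.2)),
      pmass_prodM μ₂ (prodM μ₁ μ₂) X₂ (fun q => (X₁ q.1, X₂ q.2)), pmass_prodM]
    ring
  have ea : ent M (fun p => X₁ p.1) = ent μ₁ X₁ := ent_dist pa
  have eb : ent M (fun p => X₂ p.2.1) = ent μ₂ X₂ := ent_dist pb
  have hr : rdist μ₁ X₁ μ₂ X₂ = ent M (fun p => X₁ p.1 + X₂ p.2.1)
      - ent M (fun p => X₁ p.1) / 2 - ent M (fun p => X₂ p.2.1) / 2 := by
    have e := ent_add_congr (four_pairs hm4 h4).1 (ind_prodM hμ₁ hμ₂ X₁ X₂)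
      (fun s => (pa s).trans (pmass_prodM_fst μ₁ hμ₂ X₁ s).symm)
      (fun s => (pb s).trans (pmass_prodM_snd μ₂ hμ₁ X₂ s).symm)
    rw [e, ea, eb]
    unfold rdist
    simp only [vv_sub]
    unfold prodM
    rfl
  have hD : ∀ {Ω₀ Ω' : Type} [Fintype Ω₀] [Fintype Ω'] (μ₀ : Ω₀ → ℝ) (X₀ : Ω₀ → VV n) (μ' : Ω' → ℝ)
      (X' : Ω' → VV n) (F : Ω₁ × Ω₂ × Ω₁ × Ω₂ → VV n), IsProb μ₀ → IsProb μ' →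
      (∀ s, pmass M F s = pmass μ' X' s) →
      rdist μ₀ X₀ μ' X' = DD μ₀ X₀ M F (fun _ => ()) := by
    intro Ω₀ Ω' _ _ μ₀ X₀ μ' X' F h0 h' h
    have e : DD μ₀ X₀ M F (fun _ => ()) = DD μ₀ X₀ μ' X' (fun _ => ()) :=
      DD_dist _ _ fun s => pmass_comp_congr h (fun x => (x, ())) s
    rw [e]
    unfold DD
    rw [ent_pair_unit, ent_pair_unit, ent_unit h']
    unfold rdist
    simp only [vv_sub]
    unfold prodM
    ring
  refine main_false hyp hμ₀₁ hμ₀₂ hm4 _ _ _ _ h4 (fun s => (pa s).trans (pc s).symm)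
    (fun s => (pb s).trans (pd s).symm) (by rw [← hr]; exact hpos) ?_
  rw [← hr, ← hD μ₀₁ X₀₁ μ₁ X₁ _ hμ₀₁ hμ₁ pa, ← hD μ₀₂ X₀₂ μ₂ X₂ _ hμ₀₂ hμ₂ pb]

end
end
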